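/- Let k ≥ 2 and let (Σ_k, σ) be the k-symbol full shift. Suppose φ : Σ_k → ℝ is continuous with I_φ(σ) ≠ ∅, and let a ∈ Int(L_φ(σ)). Then for each i = 1,…,6, each of the three sets I_φ(σ) ∩ {x ∈ Rec(Σ_k) \ BR(Σ_k) : x satisfies Case (i')}, R_φ(a) ∩ {x ∈ Rec(Σ_k) \ BR(Σ_k) : x satisfies Case (i')}, and R_φ ∩ {x ∈ Rec(Σ_k) \ BR(Σ_k) : x satisfies Case (i')} contains an uncountable DC1-scrambled subset. -/

import Mathlib

open Filter Topology MeasureTheory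

/-- Upper density of a set of naturals. -/
noncomputable def upperDensity (S : Set ℕ) : ℝ :=
  Filter.limsup (fun n => ((S ∩ Set.Iio n).ncard : ℝ) / n) Filter.atTop

/-- Lower density of a set of naturals. -/
noncomputable def lowerDensity (S : Set ℕ) : ℝ :=
  Filter.liminf (fun n => ((S ∩ Set.Iio n).ncard : ℝ) / n) Filter.atTop

/-- Banach upper density: limsup over the interval length of the maximal
proportion of `S` in an interval of that length. -/
noncomputable def banachUpperDensity (S : Set ℕ) : ℝ :=
  Filter.limsup (fun N => ⨆ a : ℕ, ((S ∩ Set.Ico a (a + N)).ncard : ℝ) / N) Filter.atTop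

/-- Banach lower density. -/
noncomputable def banachLowerDensity (S : Set ℕ) : ℝ :=
  Filter.liminf (fun N => ⨅ a : ℕ, ((S ∩ Set.Ico a (a + N)).ncard : ℝ) / N) Filter.atTop

/-- The shift map on the full shift `Σ_k = {0, …, k-1}^ℕ`. -/
def shift {k : ℕ} (x : ℕ → Fin k) : ℕ → Fin k := fun n => x (n + 1)

/-- The metric `d(x,y) = Σ_{n ≥ 1} δ(x_n, y_n)/2^n` on `Σ_k` (sequences indexed from `0`). -/
noncomputable def shiftDist {k : ℕ} (x y : ℕ → Fin k) : ℝ :=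
  ∑' n : ℕ, if x n = y n then 0 else (1 / 2) ^ (n + 1)

/-- The open ball `B_ε(x)` for the metric `shiftDist`. -/
def sball {k : ℕ} (x : ℕ → Fin k) (ε : ℝ) : Set (ℕ → Fin k) := {y | shiftDist x y < ε}

/-- `N(x, U) = {n ≥ 1 : σ^n(x) ∈ U}`. -/
def visits {k : ℕ} (x : ℕ → Fin k) (U : Set (ℕ → Fin k)) : Set ℕ :=
  {n | 1 ≤ n ∧ shift^[n] x ∈ U}

/-- A point is recurrent if `N(x, B_ε(x)) ≠ ∅` for every `ε > 0`. -/
def Recurrent {k : ℕ} (x : ℕ → Fin k) : Prop := ∀ ε > (0 : ℝ), (visits x (sball x ε)).Nonempty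

/-- A point is Banach recurrent if `N(x, B_ε(x))` has positive Banach upper density
for every `ε > 0`. -/
def BanachRecurrent {k : ℕ} (x : ℕ → Fin k) : Prop :=
  ∀ ε > (0 : ℝ), 0 < banachUpperDensity (visits x (sball x ε))

/-- Statistical ω-limit set w.r.t. a density notion `ξ`:
`ω_ξ(x) = {y : ξ(N(x, B_ε(y))) > 0 for all ε > 0}`. -/
def statOmega {k : ℕ} (ξ : Set ℕ → ℝ) (x : ℕ → Fin k) : Set (ℕ → Fin k) :=
  {y | ∀ ε > (0 : ℝ), 0 < ξ (visits x (sball y ε))}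

/-- The usual ω-limit set of `x` under the shift. -/
def omegaLim {k : ℕ} (x : ℕ → Fin k) : Set (ℕ → Fin k) :=
  {y | ∀ ε > (0 : ℝ), ∀ N : ℕ, ∃ n ≥ N, shift^[n] x ∈ sball y ε}

/-- Density of a subset of `Σ_k` w.r.t. the metric `shiftDist`. -/
def ShiftDense {k : ℕ} (A : Set (ℕ → Fin k)) : Prop :=
  ∀ x : ℕ → Fin k, ∀ ε > (0 : ℝ), ∃ y ∈ A, shiftDist x y < ε

/-- Closure of a subset of `Σ_k` w.r.t. the metric `shiftDist`. -/
def shiftClosure {k : ℕ} (A : Set (ℕ → Fin k)) : Set (ℕ → Fin k) :=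
  {z | ∀ ε > (0 : ℝ), ∃ y ∈ A, shiftDist z y < ε}

/-- `Φ^{(n)}_{xy}(t)`: the proportion of times `0 ≤ i < n` with `d(σ^i x, σ^i y) < t`. -/
noncomputable def PhiN {k : ℕ} (x y : ℕ → Fin k) (n : ℕ) (t : ℝ) : ℝ :=
  (({i | i < n ∧ shiftDist (shift^[i] x) (shift^[i] y) < t}).ncard : ℝ) / n

/-- A pair is DC1 (distributionally chaotic of type 1) if `Φ_{xy}(s) = 0` for some `s > 0`
and `Φ*_{xy}(t) = 1` for all `t > 0`. -/
def DC1Pair {k : ℕ} (x y : ℕ → Fin k) : Prop :=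
  (∃ s > (0 : ℝ), Filter.liminf (fun n => PhiN x y n s) Filter.atTop = 0) ∧
  (∀ t > (0 : ℝ), Filter.limsup (fun n => PhiN x y n t) Filter.atTop = 1)

/-- A set with at least two points is DC1-scrambled if every pair of distinct points is DC1. -/
def DC1Scrambled {k : ℕ} (S : Set (ℕ → Fin k)) : Prop :=
  S.Nontrivial ∧ ∀ x ∈ S, ∀ y ∈ S, x ≠ y → DC1Pair x y

/-- `strictOrEq true A B` means `A ⊊ B`; `strictOrEq false A B` means `A = B`. -/
def strictOrEq {α : Type*} (b : Bool) (A B : Set α) : Prop := if b then A ⊂ B else A = B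

/-- The patterns of (strict ⊊ = `true` / equality = `false`) for the three inclusions
`ω_{B_*} ⊆ ω_{d̲} ⊆ ω_{d̄} ⊆ ω_{B*}` in Cases (1)–(6). -/
def caseFlags : Fin 6 → Bool × Bool × Bool :=
  ![(true, false, false), (true, false, true), (false, true, false),
    (true, true, false), (false, true, true), (true, true, true)]

/-- `x` satisfies Case (i), i = 1,…,6: the chain
`ω_{B_*}(x) ⊆ ω_{d̲}(x) ⊆ ω_{d̄}(x) ⊆ ω_{B*}(x) = ω_σ(x)` with strictness pattern given by
`caseFlags i`, and the last inclusion an equality. -/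
def SatCase {k : ℕ} (i : Fin 6) (x : ℕ → Fin k) : Prop :=
  strictOrEq (caseFlags i).1 (statOmega banachLowerDensity x) (statOmega lowerDensity x) ∧
  strictOrEq (caseFlags i).2.1 (statOmega lowerDensity x) (statOmega upperDensity x) ∧
  strictOrEq (caseFlags i).2.2 (statOmega upperDensity x) (statOmega banachUpperDensity x) ∧
  statOmega banachUpperDensity x = omegaLim x

/-- `x` satisfies Case (i'), i = 1,…,6: as in Case (i) but the last inclusion
`ω_{B*}(x) ⊆ ω_σ(x)` is strict. -/
def SatCase' {k : ℕ} (i : Fin 6) (x : ℕ → Fin k) : Prop :=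
  strictOrEq (caseFlags i).1 (statOmega banachLowerDensity x) (statOmega lowerDensity x) ∧
  strictOrEq (caseFlags i).2.1 (statOmega lowerDensity x) (statOmega upperDensity x) ∧
  strictOrEq (caseFlags i).2.2 (statOmega upperDensity x) (statOmega banachUpperDensity x) ∧
  statOmega banachUpperDensity x ⊂ omegaLim x
/-- The support of a measure on `Σ_k` w.r.t. the metric `shiftDist`. -/
def msupp {k : ℕ} (μ : MeasureTheory.Measure (ℕ → Fin k)) : Set (ℕ → Fin k) :=
  {z | ∀ ε > (0 : ℝ), 0 < μ (sball z ε)}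

/-- The set `M(Λ, σ)` of shift-invariant Borel probability measures giving full
measure to `Λ`. -/
def invMeasures {k : ℕ} (Λ : Set (ℕ → Fin k)) : Set (MeasureTheory.Measure (ℕ → Fin k)) :=
  {μ | MeasureTheory.IsProbabilityMeasure μ ∧ μ.map shift = μ ∧ μ Λ = 1}

/-- `V(x, σ)`: the set of weak* limit points of the sequence of empirical measures
`(1/n) Σ_{i<n} δ_{σ^i x}` of `x`, i.e. probability measures `μ` such that along some
subsequence the Birkhoff averages of every continuous function converge to `∫ g dμ`. -/
def VSet {k : ℕ} (x : ℕ → Fin k) : Set (MeasureTheory.Measure (ℕ → Fin k)) :=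
  {μ | MeasureTheory.IsProbabilityMeasure μ ∧ ∃ φ : ℕ → ℕ, StrictMono φ ∧
    ∀ g : C(ℕ → Fin k, ℝ),
      Filter.Tendsto (fun j => (∑ i ∈ Finset.range (φ j), g (shift^[i] x)) / (φ j : ℝ))
        Filter.atTop (nhds (∫ z, g z ∂μ))}

/-- The Birkhoff average `(1/n) Σ_{i<n} φ(σ^i x)`. -/
noncomputable def birkhoffAvg {k : ℕ} (φ : (ℕ → Fin k) → ℝ) (x : ℕ → Fin k) (n : ℕ) : ℝ :=
  (∑ i ∈ Finset.range n, φ (shift^[i] x)) / n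

/-- `x` belongs to the irregular set `I_φ(σ)`: its Birkhoff averages diverge. -/
def IrregularPt {k : ℕ} (φ : (ℕ → Fin k) → ℝ) (x : ℕ → Fin k) : Prop :=
  ¬ ∃ c : ℝ, Filter.Tendsto (birkhoffAvg φ x) Filter.atTop (nhds c)

/-- The set of values `∫ φ dμ` over shift-invariant Borel probability measures `μ`;
`L_φ(σ)` is the interval `[sInf, sSup]` of this set. -/
noncomputable def LphiVals (k : ℕ) (φ : (ℕ → Fin k) → ℝ) : Set ℝ :=
  {r | ∃ μ : MeasureTheory.Measure (ℕ → Fin k),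
    MeasureTheory.IsProbabilityMeasure μ ∧ μ.map shift = μ ∧ r = ∫ z, φ z ∂μ}

theorem shift_iter {k : ℕ} (x : ℕ → Fin k) (n i : ℕ) : shift^[n] x i = x (n + i) := by
  induction n generalizing x i with
  | zero => simp
  | succ n ih =>
    rw [Function.iterate_succ_apply, ih]
    simp only [shift]; congr 1; omega

/-- agreement on the first `R` letters -/
def agr {k : ℕ} (R : ℕ) (z z' : ℕ → Fin k) : Prop := ∀ i < R, z i = z' i

theorem agr.mono {k : ℕ} {R R' : ℕ} {z z' : ℕ → Fin k} (h : agr R z z') (hR : R' ≤ R) :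
    agr R' z z' := fun i hi => h i (by omega)

theorem agr.symm' {k : ℕ} {R : ℕ} {z z' : ℕ → Fin k} (h : agr R z z') : agr R z' z :=
  fun i hi => (h i hi).symm

theorem agr.trans' {k : ℕ} {R : ℕ} {z z' z'' : ℕ → Fin k} (h : agr R z z') (h' : agr R z' z'') :
    agr R z z'' := fun i hi => (h i hi).trans (h' i hi)

theorem geo_summable : Summable (fun n : ℕ => (1 / 2 : ℝ) ^ (n + 1)) := by
  have := (summable_nat_add_iff (f := fun n : ℕ => (1 / 2 : ℝ) ^ n) 1).2 summable_geometric_two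
  simpa using this

theorem sd_summable {k : ℕ} (x y : ℕ → Fin k) :
    Summable (fun n : ℕ => if x n = y n then (0 : ℝ) else (1 / 2) ^ (n + 1)) := by
  refine Summable.of_nonneg_of_le (fun n => ?_) (fun n => ?_) geo_summable
  · split_ifs <;> positivity
  · split_ifs
    · positivity
    · exact le_rfl

theorem geo_tail : ∑' n : ℕ, (1 / 2 : ℝ) ^ (n + 1) = 1 := by
  have h := tsum_geometric_two
  have e : (fun n : ℕ => (1 / 2 : ℝ) ^ (n + 1)) = fun n => (1 / 2 : ℝ) * (1 / 2) ^ n := by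
    funext n; rw [pow_succ]; ring
  rw [e, tsum_mul_left, h]; norm_num

theorem sd_le {k : ℕ} {R : ℕ} {x y : ℕ → Fin k} (h : agr R x y) :
    shiftDist x y ≤ (1 / 2) ^ R := by
  have h0 := (sd_summable x y).sum_add_tsum_nat_add R
  have h1 : ∑ i ∈ Finset.range R, (if x i = y i then (0 : ℝ) else (1 / 2) ^ (i + 1)) = 0 := by
    apply Finset.sum_eq_zero
    intro i hi
    rw [if_pos (h i (Finset.mem_range.1 hi))]
  rw [h1, zero_add] at h0
  have h2 : Summable (fun n : ℕ => (1 / 2 : ℝ) ^ R * (1 / 2 : ℝ) ^ (n + 1)) :=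
    geo_summable.mul_left _
  have h3 : ∑' n : ℕ, (1 / 2 : ℝ) ^ R * (1 / 2 : ℝ) ^ (n + 1) = (1 / 2) ^ R := by
    rw [tsum_mul_left, geo_tail, mul_one]
  have h4 : Summable (fun n : ℕ => if x (n + R) = y (n + R) then (0 : ℝ)
      else (1 / 2) ^ (n + R + 1)) :=
    (summable_nat_add_iff (f := fun n : ℕ => if x n = y n then (0 : ℝ)
      else (1 / 2) ^ (n + 1)) R).2 (sd_summable x y)
  have h5 : shiftDist x y = ∑' n : ℕ, if x (n + R) = y (n + R) then (0 : ℝ)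
      else (1 / 2) ^ (n + R + 1) := h0.symm
  rw [h5, ← h3]
  refine Summable.tsum_le_tsum (fun n => ?_) h4 h2
  have e : (1 / 2 : ℝ) ^ R * (1 / 2 : ℝ) ^ (n + 1) = (1 / 2) ^ (n + R + 1) := by
    rw [← pow_add]; congr 1; ring
  rw [e]
  split_ifs
  · positivity
  · exact le_rfl

theorem agr_of_sd {k : ℕ} {R : ℕ} {x y : ℕ → Fin k} (h : shiftDist x y < (1 / 2) ^ R) :
    agr R x y := by
  intro i hi
  by_contra hne
  have h1 := (sd_summable x y).le_tsum i (fun j _ => by split_ifs <;> positivity)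
  rw [if_neg hne] at h1
  have h2 : (1 / 2 : ℝ) ^ R ≤ (1 / 2) ^ (i + 1) :=
    pow_le_pow_of_le_one (by norm_num) (by norm_num) hi
  unfold shiftDist at h
  linarith

theorem exists_half_pow {ε : ℝ} (hε : 0 < ε) : ∃ R : ℕ, (1 / 2 : ℝ) ^ R < ε :=
  exists_pow_lt_of_lt_one hε (by norm_num)

/-- Birkhoff sums -/
noncomputable def bs {k : ℕ} (g : (ℕ → Fin k) → ℝ) (z : ℕ → Fin k) (N : ℕ) : ℝ :=
  ∑ i ∈ Finset.range N, g (shift^[i] z)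

/-- bounded by `M` and uniformly continuous -/
def Reg {k : ℕ} (g : (ℕ → Fin k) → ℝ) (M : ℝ) : Prop :=
  (∀ z, |g z| ≤ M) ∧ ∀ ε > (0 : ℝ), ∃ R : ℕ, ∀ z z', agr R z z' → |g z - g z'| ≤ ε

theorem Reg.mono {k : ℕ} {g : (ℕ → Fin k) → ℝ} {M M' : ℝ} (h : Reg g M) (hM : M ≤ M') :
    Reg g M' := ⟨fun z => (h.1 z).trans hM, h.2⟩

theorem Reg.neg {k : ℕ} {g : (ℕ → Fin k) → ℝ} {M : ℝ} (h : Reg g M) :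
    Reg (fun z => - g z) M := by
  refine ⟨fun z => by simpa using h.1 z, fun ε hε => ?_⟩
  obtain ⟨R, hR⟩ := h.2 ε hε
  refine ⟨R, fun z z' hz => ?_⟩
  have := hR z z' hz
  rw [abs_sub_comm] at this
  convert this using 2
  ring

theorem bs_neg {k : ℕ} (g : (ℕ → Fin k) → ℝ) (z : ℕ → Fin k) (N : ℕ) :
    bs (fun z => - g z) z N = - bs g z N := by
  simp [bs]

theorem bs_add {k : ℕ} (g : (ℕ → Fin k) → ℝ) (z : ℕ → Fin k) (a b : ℕ) :
    bs g z (a + b) = bs g z a + bs g (shift^[a] z) b := by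
  unfold bs
  rw [Finset.sum_range_add]
  congr 1
  refine Finset.sum_congr rfl fun i _ => ?_
  rw [← Function.iterate_add_apply, add_comm]

theorem bs_abs_le {k : ℕ} {g : (ℕ → Fin k) → ℝ} {M : ℝ} (h : Reg g M) (z : ℕ → Fin k) (N : ℕ) :
    |bs g z N| ≤ M * N := by
  unfold bs
  refine (Finset.abs_sum_le_sum_abs _ _).trans ?_
  refine (Finset.sum_le_sum fun i _ => h.1 (shift^[i] z)).trans ?_
  simp [mul_comm]

theorem Reg.nonneg {k : ℕ} {g : (ℕ → Fin k) → ℝ} {M : ℝ} (h : Reg g M) (z : ℕ → Fin k) : 0 ≤ M :=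
  (abs_nonneg _).trans (h.1 z)

theorem Reg_of_continuous {k : ℕ} (φ : (ℕ → Fin k) → ℝ) (hφ : Continuous φ) :
    ∃ M, Reg φ M := by
  have hc : IsCompact (Set.univ : Set (ℕ → Fin k)) := isCompact_univ
  obtain ⟨M, hM⟩ := hc.exists_bound_of_continuousOn hφ.continuousOn
  refine ⟨M, fun z => hM z trivial, fun ε hε => ?_⟩
  have key : ∀ z : ℕ → Fin k, ∃ R : ℕ, ∀ z', agr R z z' → |φ z' - φ z| < ε / 2 := by
    intro z
    have ho : IsOpen {z' | |φ z' - φ z| < ε / 2} :=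
      isOpen_lt (by fun_prop) continuous_const
    obtain ⟨v, ⟨w, n, rfl⟩, hz, hv⟩ :=
      (PiNat.isTopologicalBasis_cylinders (fun _ : ℕ => Fin k)).exists_subset_of_mem_open
        (show z ∈ {z' | |φ z' - φ z| < ε / 2} by simp [hε]) ho
    refine ⟨n, fun z' hz' => hv ?_⟩
    rw [PiNat.mem_cylinder_iff] at hz ⊢
    intro i hi
    rw [← hz i hi, hz' i hi]
  choose R hR using key
  obtain ⟨t, ht⟩ := hc.elim_finite_subcover (fun z => PiNat.cylinder (E := fun _ => Fin k) z (R z))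
    (fun z => PiNat.isOpen_cylinder _ z _)
    (fun z _ => Set.mem_iUnion.2 ⟨z, PiNat.self_mem_cylinder z _⟩)
  refine ⟨t.sup R, fun z z' hz => ?_⟩
  obtain ⟨w, hw⟩ := Set.mem_iUnion.1 (ht (Set.mem_univ z))
  obtain ⟨hwt, hw⟩ := Set.mem_iUnion.1 hw
  have hle : R w ≤ t.sup R := Finset.le_sup hwt
  have h1 : agr (R w) w z := fun i hi => ((PiNat.mem_cylinder_iff.1 hw) i hi).symm
  have h2 : agr (R w) w z' := h1.trans' (hz.mono hle)
  have a1 := hR w z h1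
  have a2 := hR w z' h2
  rw [abs_lt] at a1 a2
  rw [abs_le]
  constructor <;> linarith [a1.1, a1.2, a2.1, a2.2]

open Classical in
/-- indicator of a cylinder -/
noncomputable def cyl {k : ℕ} (R : ℕ) (y : ℕ → Fin k) (z : ℕ → Fin k) : ℝ :=
  if agr R y z then 1 else 0

theorem cyl_reg {k : ℕ} (R : ℕ) (y : ℕ → Fin k) : Reg (cyl R y) 1 := by
  refine ⟨fun z => ?_, fun ε hε => ⟨R, fun z z' h => ?_⟩⟩
  · unfold cyl; split_ifs <;> simp
  · have : agr R y z ↔ agr R y z' := ⟨fun h' => h'.trans' h, fun h' => h'.trans' h.symm'⟩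
    have e : cyl R y z = cyl R y z' := by
      unfold cyl
      by_cases hh : agr R y z
      · rw [if_pos hh, if_pos (this.1 hh)]
      · rw [if_neg hh, if_neg (fun h' => hh (this.2 h'))]
    rw [e, sub_self, abs_zero]
    exact hε.le

/-- transfer of Birkhoff sums between sequences that agree for a long time -/
theorem bs_transfer {k : ℕ} {g : (ℕ → Fin k) → ℝ} {M : ℝ} (h : Reg g M) (ε : ℝ) (hε : 0 < ε) :
    ∃ C : ℝ, 0 ≤ C ∧ ∀ (z z' : ℕ → Fin k) (N : ℕ), agr N z z' →
      |bs g z N - bs g z' N| ≤ ε * N + C := by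
  by_cases hne : Nonempty (ℕ → Fin k)
  swap
  · exact ⟨0, le_rfl, fun z => (hne ⟨z⟩).elim⟩
  obtain ⟨z0⟩ := hne
  have hM := h.nonneg z0
  obtain ⟨R, hR⟩ := h.2 ε hε
  refine ⟨2 * M * R, by positivity, fun z z' N hz => ?_⟩
  have key : ∀ n ≤ N, |bs g z n - bs g z' n| ≤ ε * n + 2 * M * ((n + R - N : ℕ) : ℝ) := by
    intro n
    induction n with
    | zero => intro _; simp [bs]; positivity
    | succ n ih =>
      intro hn
      have ih' := ih (by omega)
      have e : bs g z (n + 1) - bs g z' (n + 1) =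
          (bs g z n - bs g z' n) + (g (shift^[n] z) - g (shift^[n] z')) := by
        simp only [bs, Finset.sum_range_succ]; ring
      rw [e]
      have h3 := abs_add_le (bs g z n - bs g z' n) (g (shift^[n] z) - g (shift^[n] z'))
      by_cases hc : n + R < N
      · have h1 : |g (shift^[n] z) - g (shift^[n] z')| ≤ ε := by
          apply hR
          intro i hi
          rw [shift_iter, shift_iter]
          exact hz _ (by omega)
        have h0 : n + R - N = 0 := by omega
        have h0' : n + 1 + R - N = 0 := by omega
        rw [h0] at ih'
        rw [h0']
        push_cast at *
        linarith
      · have h1 : |g (shift^[n] z) - g (shift^[n] z')| ≤ 2 * M := by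
          have a1 := abs_le.1 (h.1 (shift^[n] z))
          have a2 := abs_le.1 (h.1 (shift^[n] z'))
          rw [abs_le]; constructor <;> linarith [a1.1, a1.2, a2.1, a2.2]
        have h0' : n + 1 + R - N = (n + R - N) + 1 := by omega
        rw [h0']
        push_cast at *
        linarith
  have := key N le_rfl
  simpa using this

open Classical in
/-- number of elements of `S` in the window `[a, a+N)` -/
noncomputable def cnt (S : Set ℕ) (a N : ℕ) : ℕ :=
  ((Finset.Ico a (a + N)).filter (fun i => i ∈ S)).card

theorem cnt_eq_ncard (S : Set ℕ) (a N : ℕ) : (S ∩ Set.Ico a (a + N)).ncard = cnt S a N := by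
  classical
  unfold cnt
  rw [← Set.ncard_coe_finset]
  congr 1
  ext i
  simp only [Set.mem_inter_iff, Set.mem_Ico, Finset.coe_filter, Finset.mem_Ico, Set.mem_ofPred_eq]
  tauto

theorem cnt_mono {S T : Set ℕ} (h : S ⊆ T) (a N : ℕ) : cnt S a N ≤ cnt T a N := by
  classical
  unfold cnt
  apply Finset.card_le_card
  intro i
  simp only [Finset.mem_filter]
  exact fun hi => ⟨hi.1, h hi.2⟩

theorem cnt_le (S : Set ℕ) (a N : ℕ) : cnt S a N ≤ N := by
  classical
  unfold cnt
  refine (Finset.card_filter_le _ _).trans ?_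
  simp

theorem cnt_split (S : Set ℕ) (a N N' : ℕ) :
    cnt S a (N + N') = cnt S a N + cnt S (a + N) N' := by
  classical
  unfold cnt
  rw [← add_assoc, ← Finset.Ico_union_Ico_eq_Ico (show a ≤ a + N by omega)
    (show a + N ≤ a + N + N' by omega), Finset.filter_union, Finset.card_union_of_disjoint]
  apply Finset.disjoint_filter_filter
  exact Finset.Ico_disjoint_Ico_consecutive _ _ _

theorem cnt_union (S T : Set ℕ) (a N : ℕ) : cnt (S ∪ T) a N ≤ cnt S a N + cnt T a N := by
  classical
  unfold cnt
  refine le_trans (Finset.card_le_card ?_) (Finset.card_union_le _ _)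
  intro i
  simp only [Finset.mem_filter, Finset.mem_union, Set.mem_union]; tauto

theorem cnt_translate {S T : Set ℕ} {a b N : ℕ} (h : ∀ i < N, a + i ∈ S → b + i ∈ T) :
    cnt S a N ≤ cnt T b N := by
  classical
  unfold cnt
  refine Finset.card_le_card_of_injOn (fun i => b + (i - a)) ?_ ?_
  · intro i hi
    simp only [Finset.coe_filter, Finset.mem_Ico, Set.mem_ofPred_eq] at hi ⊢
    refine ⟨by omega, h _ (by omega) ?_⟩
    rw [show a + (i - a) = i by omega]; exact hi.2
  · intro i hi j hj hij
    simp only [Finset.coe_filter, Finset.mem_Ico, Set.mem_ofPred_eq] at hi hj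
    dsimp at hij
    omega

theorem cnt_chunk (S : Set ℕ) (D κ : ℕ) (hD : 0 < D) (h : ∀ a, ∀ N ≤ D, cnt S a N ≤ κ) (a N : ℕ) :
    cnt S a N ≤ (N / D + 1) * κ := by
  induction N using Nat.strong_induction_on generalizing a with
  | _ N ih =>
    by_cases hN : N ≤ D
    · refine (h a N hN).trans ?_
      exact Nat.le_mul_of_pos_left _ (Nat.succ_pos _)
    · have e : N = D + (N - D) := by omega
      have h1 := ih (N - D) (by omega) (a + D)
      have h2 := h a D le_rfl
      have e2 : N / D = (N - D) / D + 1 := by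
        conv_lhs => rw [e]
        rw [Nat.add_div_left _ hD]
      rw [e2]
      calc cnt S a N = cnt S a D + cnt S (a + D) (N - D) := by
            conv_lhs => rw [e]
            rw [cnt_split]
        _ ≤ _ := by nlinarith

/-- Banach density zero, with explicit bounds -/
def SmallB (S : Set ℕ) : Prop :=
  ∀ ε > (0 : ℝ), ∃ C : ℝ, 0 ≤ C ∧ ∀ a N : ℕ, (cnt S a N : ℝ) ≤ ε * N + C

/-- positions where the `R`-word seen in `z` is not a word of one of the orbits -/
def Bad {k m : ℕ} (U : Fin m → ℕ → Fin k) (R : ℕ) (z : ℕ → Fin k) : Set ℕ :=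
  {i | ∀ j s, ¬ agr R (shift^[i] z) (shift^[s] (U j))}

def SqSet (l R : ℕ) : Set ℕ := {p | ∃ q, p < l * q ^ 2 ∧ l * q ^ 2 ≤ p + R}

theorem sq_cnt (l R : ℕ) (hl : 0 < l) (a N : ℕ) :
    cnt (SqSet l R) a N ≤ (Nat.sqrt (N + R) + 3) * R := by
  classical
  set s := Nat.sqrt (N + R) with hs
  set q0 := Nat.sqrt (a / l) with hq0
  have hs1 : N + R < (s + 1) ^ 2 := by
    rw [pow_two]; exact Nat.lt_succ_sqrt (N + R)
  have ha1 : a / l < (q0 + 1) ^ 2 := by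
    rw [pow_two]; exact Nat.lt_succ_sqrt (a / l)
  have ha2 : q0 ^ 2 ≤ a / l := by
    rw [pow_two]; exact Nat.sqrt_le (a / l)
  have ha3 : a < l * (q0 + 1) ^ 2 := by
    rw [mul_comm]; exact (Nat.div_lt_iff_lt_mul hl).1 ha1
  have ha4 : l * q0 ^ 2 ≤ a := by
    rw [mul_comm]; exact (Nat.le_div_iff_mul_le hl).1 ha2
  have hsub : (Finset.Ico a (a + N)).filter (fun i => i ∈ SqSet l R) ⊆
      (Finset.Icc q0 (q0 + 2 + s)).biUnion (fun q => Finset.Ico (l * q ^ 2 - R) (l * q ^ 2)) := by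
    intro p hp
    rw [Finset.mem_filter, Finset.mem_Ico] at hp
    obtain ⟨⟨hp1, hp2⟩, q, hq1, hq2⟩ := hp
    simp only [Finset.mem_biUnion, Finset.mem_Icc, Finset.mem_Ico]
    refine ⟨q, ⟨?_, ?_⟩, by omega, hq1⟩
    · by_contra hlt
      push Not at hlt
      have : q ^ 2 ≤ q0 ^ 2 := Nat.pow_le_pow_left hlt.le 2
      have := Nat.mul_le_mul_left l this
      omega
    · by_contra hlt
      push Not at hlt
      have h1 : (q0 + 1) ^ 2 + (s + 1) ^ 2 ≤ q ^ 2 := by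
        have : (q0 + 1 + (s + 1)) ^ 2 ≤ q ^ 2 := Nat.pow_le_pow_left (by omega) 2
        nlinarith
      have h2 := Nat.mul_le_mul_left l h1
      have h3 : (s + 1) ^ 2 ≤ l * (s + 1) ^ 2 := Nat.le_mul_of_pos_left _ hl
      rw [mul_add] at h2
      omega
  unfold cnt
  refine (Finset.card_le_card hsub).trans ?_
  refine Finset.card_biUnion_le.trans ?_
  refine (Finset.sum_le_card_nsmul _ _ R ?_).trans ?_
  · intro q _; simp only [Nat.card_Ico]; omega
  · simp only [Nat.card_Icc, smul_eq_mul]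
    apply Nat.mul_le_mul_right; omega

theorem sqrt_small (n : ℕ) (δ : ℝ) (hδ : 0 < δ) : (Nat.sqrt n : ℝ) ≤ δ * n + 1 / δ := by
  have h : ((Nat.sqrt n : ℝ)) ^ 2 ≤ n := by exact_mod_cast Nat.sqrt_le' n
  have h3 : (Nat.sqrt n : ℝ) ≤ δ * (Nat.sqrt n : ℝ) ^ 2 + 1 / δ := by
    have h4 : 0 ≤ (1 / δ) * (δ * (Nat.sqrt n : ℝ) - 1) ^ 2 + Nat.sqrt n := by positivity
    have h5 : (1 / δ) * (δ * (Nat.sqrt n : ℝ) - 1) ^ 2 + Nat.sqrt n =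
      δ * (Nat.sqrt n : ℝ) ^ 2 + 1 / δ - Nat.sqrt n := by
      field_simp; ring
    linarith
  nlinarith

theorem sq_small (l R : ℕ) (hl : 0 < l) : SmallB (SqSet l R) := by
  intro ε hε
  have hδ : (0 : ℝ) < ε / (R + 1) := by positivity
  refine ⟨(ε / (R + 1) * R + 1 / (ε / (R + 1)) + 3) * R, by positivity, fun a N => ?_⟩
  have h1 : (cnt (SqSet l R) a N : ℝ) ≤ ((Nat.sqrt (N + R) : ℝ) + 3) * R := by
    exact_mod_cast sq_cnt l R hl a N
  have h2 := sqrt_small (N + R) _ hδ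
  push_cast at h2
  have h3 : ε / (R + 1) * N * R ≤ ε * N := by
    have : ε / (R + 1) * N * R = ε * N * (R / (R + 1)) := by ring
    rw [this]
    have h4 : (R : ℝ) / (R + 1) ≤ 1 := by
      rw [div_le_one (by positivity)]; linarith
    exact mul_le_of_le_one_right (by positivity) h4
  have hR : (0 : ℝ) ≤ R := by positivity
  have h5 := mul_le_mul_of_nonneg_right h2 hR
  nlinarith

theorem greedy {m : ℕ} (c : Fin m → ℝ) (hc0 : ∀ j, 0 ≤ c j) (hc1 : ∑ j, c j = 1) :
    ∃ K : ℕ → Fin m, ∀ (Q : ℕ) (j : Fin m),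
      |∑ q ∈ Finset.range Q, (2 * (q : ℝ) + 1) * (if K q = j then 1 else 0) - c j * (Q : ℝ) ^ 2|
        ≤ m * (2 * Q + 1) := by
  have hne : Nonempty (Fin m) := by
    by_contra h
    rw [not_nonempty_iff] at h
    simp at hc1
  have hle1 : ∀ j, c j ≤ 1 := fun j => by
    rw [← hc1]; exact Finset.single_le_sum (fun i _ => hc0 i) (Finset.mem_univ j)
  have ham : ∀ D : Fin m → ℝ, ∃ j, ∀ i, D i ≤ D j := fun D => Finite.exists_max D
  choose am ham using ham
  let D : ℕ → Fin m → ℝ := fun n => Nat.rec (fun _ => 0)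
    (fun n D => fun j => D j + (2 * (n : ℝ) + 1) * (c j - if am D = j then 1 else 0)) n
  have D0 : ∀ j, D 0 j = 0 := fun j => rfl
  have DS : ∀ n j, D (n + 1) j =
    D n j + (2 * (n : ℝ) + 1) * (c j - if am (D n) = j then 1 else 0) := fun n j => rfl
  have hsum : ∀ n, ∑ j, D n j = 0 := by
    intro n
    induction n with
    | zero => simp [D0]
    | succ n ih =>
      simp only [DS, Finset.sum_add_distrib, ih, ← Finset.mul_sum, Finset.sum_sub_distrib, hc1]
      simp
  have hpos : ∀ n, 0 ≤ D n (am (D n)) := by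
    intro n
    by_contra h
    push Not at h
    have : ∑ j, D n j < 0 := by
      apply Finset.sum_neg (fun i _ => lt_of_le_of_lt (ham (D n) i) h)
      exact Finset.univ_nonempty
    linarith [hsum n]
  have hlow : ∀ (n : ℕ) j, -(2 * (n : ℝ) + 1) ≤ D n j := by
    intro n
    induction n with
    | zero => intro j; simp [D0]
    | succ n ih =>
      intro j
      rw [DS]
      have hn : (0 : ℝ) ≤ n := by positivity
      by_cases hj : am (D n) = j
      · have h1 := hpos n
        rw [hj] at h1
        rw [if_pos hj]
        push_cast
        have := mul_nonneg (show (0 : ℝ) ≤ 2 * n + 1 by positivity) (hc0 j)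
        nlinarith
      · rw [if_neg hj]
        have := mul_nonneg (show (0 : ℝ) ≤ 2 * n + 1 by positivity) (hc0 j)
        push_cast
        have := ih j
        linarith
  have hcnt : ∀ n j, D n j = c j * (n : ℝ) ^ 2 -
      ∑ q ∈ Finset.range n, (2 * (q : ℝ) + 1) * (if am (D q) = j then 1 else 0) := by
    intro n j
    induction n with
    | zero => simp [D0]
    | succ n ih =>
      rw [DS, ih, Finset.sum_range_succ]
      push_cast
      ring
  refine ⟨fun n => am (D n), fun Q j => ?_⟩
  rw [abs_sub_comm, ← hcnt Q j, abs_le]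
  have hm : (1 : ℝ) ≤ m := by
    have : 0 < m := Fin.pos_iff_nonempty.2 hne
    exact_mod_cast this
  have hQ : (0 : ℝ) ≤ Q := by positivity
  constructor
  · have := hlow Q j
    nlinarith
  · have h1 := Finset.add_sum_erase Finset.univ (D Q) (Finset.mem_univ j)
    rw [hsum Q] at h1
    have h2 : ∑ i ∈ Finset.univ.erase j, (-(2 * (Q : ℝ) + 1)) ≤ ∑ i ∈ Finset.univ.erase j, D Q i :=
      Finset.sum_le_sum fun i _ => hlow Q i
    rw [Finset.sum_const, Finset.card_erase_of_mem (Finset.mem_univ j), Finset.card_univ,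
      Fintype.card_fin, nsmul_eq_mul] at h2
    have h3 : ((m - 1 : ℕ) : ℝ) ≤ m := by exact_mod_cast Nat.sub_le m 1
    nlinarith

theorem sum_sqrt (f : ℕ → ℝ) (Q : ℕ) :
    ∑ t ∈ Finset.range (Q ^ 2), f (Nat.sqrt t) = ∑ q ∈ Finset.range Q, (2 * (q : ℝ) + 1) * f q := by
  induction Q with
  | zero => simp
  | succ Q ih =>
    rw [Finset.sum_range_succ, ← ih, show (Q + 1) ^ 2 = Q ^ 2 + (2 * Q + 1) by ring,
      Finset.sum_range_add]
    congr 1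
    have : ∀ i ∈ Finset.range (2 * Q + 1), f (Nat.sqrt (Q ^ 2 + i)) = f Q := by
      intro i hi
      rw [Finset.mem_range] at hi
      congr 1
      rw [pow_two]
      exact Nat.sqrt_add_eq Q (by omega)
    rw [Finset.sum_congr rfl this]
    simp

theorem J_avg {m : ℕ} (c : Fin m → ℝ) (K : ℕ → Fin m)
    (hK : ∀ (Q : ℕ) (j : Fin m),
      |∑ q ∈ Finset.range Q, (2 * (q : ℝ) + 1) * (if K q = j then 1 else 0) - c j * (Q : ℝ) ^ 2|
        ≤ m * (2 * Q + 1)) (h : Fin m → ℝ) :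
    ∃ C : ℝ, 0 ≤ C ∧ ∀ T : ℕ,
      |∑ t ∈ Finset.range T, h (K (Nat.sqrt t)) - T * ∑ j, c j * h j| ≤ C * (Nat.sqrt T + 1) := by
  set H := ∑ j, |h j| with hH
  set G := ∑ j, c j * h j with hG
  have hHj : ∀ j, |h j| ≤ H := fun j =>
    Finset.single_le_sum (f := fun j => |h j|) (fun i _ => abs_nonneg _) (Finset.mem_univ j)
  have hH0 : 0 ≤ H := Finset.sum_nonneg fun i _ => abs_nonneg _
  refine ⟨2 * m * H + 2 * (H + |G|), by positivity, fun T => ?_⟩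
  set Q := Nat.sqrt T with hQ
  have h1 : Q ^ 2 ≤ T := Nat.sqrt_le' T
  have h2 : T ≤ Q ^ 2 + 2 * Q := by
    have h2' := Nat.sqrt_le_add T
    rw [← hQ] at h2'
    rw [pow_two]; omega
  obtain ⟨r, hr⟩ := Nat.exists_eq_add_of_le h1
  have hr2 : r ≤ 2 * Q := by omega
  rw [hr, Finset.sum_range_add, sum_sqrt (fun q => h (K q)) Q]
  have e1 : ∑ q ∈ Finset.range Q, (2 * (q : ℝ) + 1) * h (K q) =
      ∑ j, (∑ q ∈ Finset.range Q, (2 * (q : ℝ) + 1) * (if K q = j then 1 else 0)) * h j := by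
    simp only [Finset.sum_mul]
    rw [Finset.sum_comm]
    refine Finset.sum_congr rfl fun q _ => ?_
    rw [Finset.sum_eq_single (K q)]
    · simp
    · intro j _ hj; simp [Ne.symm hj]
    · simp
  have e2 : |∑ q ∈ Finset.range Q, (2 * (q : ℝ) + 1) * h (K q) - (Q : ℝ) ^ 2 * G| ≤
      m * (2 * Q + 1) * H := by
    rw [e1, hG, Finset.mul_sum, ← Finset.sum_sub_distrib, hH, Finset.mul_sum]
    refine (Finset.abs_sum_le_sum_abs _ _).trans (Finset.sum_le_sum fun j _ => ?_)
    have := hK Q j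
    calc _ = |(∑ q ∈ Finset.range Q, (2 * (q : ℝ) + 1) * (if K q = j then 1 else 0) -
          c j * (Q : ℝ) ^ 2) * h j| := by congr 1; ring
      _ = _ := abs_mul _ _
      _ ≤ _ := mul_le_mul_of_nonneg_right this (abs_nonneg _)
  have e3 : |∑ i ∈ Finset.range r, h (K (Nat.sqrt (Q ^ 2 + i)))| ≤ r * H := by
    refine (Finset.abs_sum_le_sum_abs _ _).trans ?_
    refine (Finset.sum_le_sum fun i _ => hHj _).trans ?_
    simp
  have hrR : (r : ℝ) ≤ 2 * Q := by exact_mod_cast hr2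
  have e4 : |(r : ℝ) * G| ≤ 2 * Q * |G| := by
    rw [abs_mul, Nat.abs_cast]
    exact mul_le_mul_of_nonneg_right hrR (abs_nonneg _)
  have e5 : (r : ℝ) * H ≤ 2 * Q * H := mul_le_mul_of_nonneg_right hrR hH0
  have hm : (0 : ℝ) ≤ m := by positivity
  have hmH : (0 : ℝ) ≤ m * H := by positivity
  have hG0 := abs_nonneg G
  rw [abs_le] at e2 e3 e4 ⊢
  push_cast
  constructor <;> nlinarith [e2.1, e2.2, e3.1, e3.2, e4.1, e4.2]

/-- base sequence -/
def Yseq {k m : ℕ} (U : Fin m → ℕ → Fin k) (l : ℕ) (K : ℕ → Fin m) : ℕ → Fin k :=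
  fun p => U (K (Nat.sqrt (p / l))) p

theorem Y_agr {k m : ℕ} (U : Fin m → ℕ → Fin k) (l : ℕ) (hl : 0 < l) (K : ℕ → Fin m) (R p : ℕ)
    (hp : p ∉ SqSet l R) :
    agr R (shift^[p] (Yseq U l K)) (shift^[p] (U (K (Nat.sqrt (p / l))))) := by
  intro i hi
  rw [shift_iter, shift_iter]
  unfold Yseq
  have : Nat.sqrt ((p + i) / l) = Nat.sqrt (p / l) := by
    by_contra hne
    have hle : Nat.sqrt (p / l) ≤ Nat.sqrt ((p + i) / l) :=
      Nat.sqrt_le_sqrt (Nat.div_le_div_right (by omega))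
    apply hp
    refine ⟨Nat.sqrt ((p + i) / l), ?_, ?_⟩
    · have h1 : p / l < Nat.sqrt ((p + i) / l) ^ 2 := by
        rw [pow_two]; exact Nat.sqrt_lt.1 (by omega)
      rw [mul_comm]; exact (Nat.div_lt_iff_lt_mul hl).1 h1
    · have h1 := Nat.sqrt_le' ((p + i) / l)
      have := (Nat.le_div_iff_mul_le hl).1 h1
      rw [mul_comm] at this; omega
  rw [this]

theorem Y_bad {k m : ℕ} (U : Fin m → ℕ → Fin k) (l : ℕ) (hl : 0 < l) (K : ℕ → Fin m) (R : ℕ) :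
    Bad U R (Yseq U l K) ⊆ SqSet l R := by
  intro p hp
  by_contra h
  exact hp _ _ (Y_agr U l hl K R p h)

theorem per_iter {k : ℕ} {u : ℕ → Fin k} {l : ℕ} (hu : ∀ i, u (i + l) = u i) (t s : ℕ) :
    shift^[l * t + s] u = shift^[s] u := by
  funext i
  rw [shift_iter, shift_iter]
  induction t with
  | zero => simp
  | succ t ih =>
    rw [← ih, ← hu (l * t + s + i)]
    congr 1; ring

/-- asymptotic Birkhoff average -/
def HasAvg {k : ℕ} (g : (ℕ → Fin k) → ℝ) (z : ℕ → Fin k) (G : ℝ) : Prop :=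
  ∀ ε > (0 : ℝ), ∃ C : ℝ, 0 ≤ C ∧ ∀ N : ℕ, |bs g z N - N * G| ≤ ε * N + C

theorem Y_avg {k m : ℕ} (U : Fin m → ℕ → Fin k) (l : ℕ) (hl : 0 < l)
    (hper : ∀ j i, U j (i + l) = U j i) (c : Fin m → ℝ) (K : ℕ → Fin m)
    (hK : ∀ (Q : ℕ) (j : Fin m),
      |∑ q ∈ Finset.range Q, (2 * (q : ℝ) + 1) * (if K q = j then 1 else 0) - c j * (Q : ℝ) ^ 2|
        ≤ m * (2 * Q + 1))
    (g : (ℕ → Fin k) → ℝ) (M : ℝ) (hg : Reg g M) :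
    HasAvg g (Yseq U l K) (∑ j, c j * (bs g (U j) l / l)) := by
  classical
  intro ε hε
  have hM : 0 ≤ M := hg.nonneg (U (K 0))
  have hl' : (0 : ℝ) < l := by exact_mod_cast hl
  have hl1 : (1 : ℝ) ≤ l := by exact_mod_cast hl
  set h : Fin m → ℝ := fun j => bs g (U j) l / l with hh
  set G := ∑ j, c j * h j with hG
  obtain ⟨C1, hC1, hJ⟩ := J_avg c K hK h
  -- the ideal sum
  let A : ℕ → ℝ := fun N => ∑ i ∈ Finset.range N, g (shift^[i] (U (K (Nat.sqrt (i / l)))))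
  have hA : ∀ T, A (l * T) = l * ∑ t ∈ Finset.range T, h (K (Nat.sqrt t)) := by
    intro T
    induction T with
    | zero => simp [A]
    | succ T ih =>
      rw [Finset.sum_range_succ, mul_add (l : ℝ), ← ih]
      simp only [A]
      rw [mul_add l, mul_one, Finset.sum_range_add]
      congr 1
      rw [hh]
      simp only
      rw [mul_div_cancel₀ _ hl'.ne', bs]
      refine Finset.sum_congr rfl fun s hs => ?_
      rw [Finset.mem_range] at hs
      have : (l * T + s) / l = T := by
        rw [Nat.mul_add_div hl, Nat.div_eq_of_lt hs, add_zero]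
      rw [this, per_iter (hper _)]
  -- comparison
  obtain ⟨R, hR⟩ := hg.2 (ε / 3) (by positivity)
  obtain ⟨C2, hC2, hS⟩ := sq_small l R hl (ε / (3 * (2 * M + 1))) (by positivity)
  have hcmp : ∀ N, |bs g (Yseq U l K) N - A N| ≤ ε / 3 * N + 2 * M * cnt (SqSet l R) 0 N := by
    intro N
    have e : bs g (Yseq U l K) N - A N = ∑ i ∈ Finset.range N,
        (g (shift^[i] (Yseq U l K)) - g (shift^[i] (U (K (Nat.sqrt (i / l)))))) := by
      simp only [bs, A, Finset.sum_sub_distrib]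
    have e2 : (cnt (SqSet l R) 0 N : ℝ) =
        ∑ i ∈ Finset.range N, if i ∈ SqSet l R then (1 : ℝ) else 0 := by
      unfold cnt
      rw [Finset.sum_boole]
      simp
    rw [e, e2, Finset.mul_sum]
    have e3 : ε / 3 * N = ∑ i ∈ Finset.range N, ε / 3 := by simp [mul_comm]
    rw [e3, ← Finset.sum_add_distrib]
    refine (Finset.abs_sum_le_sum_abs _ _).trans (Finset.sum_le_sum fun i _ => ?_)
    by_cases hi : i ∈ SqSet l R
    · rw [if_pos hi]
      have a1 := abs_le.1 (hg.1 (shift^[i] (Yseq U l K)))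
      have a2 := abs_le.1 (hg.1 (shift^[i] (U (K (Nat.sqrt (i / l))))))
      rw [abs_le]
      constructor <;> linarith [a1.1, a1.2, a2.1, a2.2]
    · rw [if_neg hi]
      have := hR _ _ (Y_agr U l hl K R i hi)
      linarith
  have hGM : 0 ≤ |G| := abs_nonneg _
  set δ : ℝ := ε / (3 * (C1 + 1)) with hδ
  have hδ0 : 0 < δ := by positivity
  refine ⟨2 * M * C2 + (l * C1 * (1 / δ + 1)) + l * M + l * |G|, by positivity, fun N => ?_⟩
  have h1 := hcmp N
  have h2 := hS 0 N
  have h3 : 2 * M * (cnt (SqSet l R) 0 N : ℝ) ≤ ε / 3 * N + 2 * M * C2 := by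
    have := mul_le_mul_of_nonneg_left h2 (show 0 ≤ 2 * M by positivity)
    have h4 : 2 * M * (ε / (3 * (2 * M + 1)) * N) ≤ ε / 3 * N := by
      have e : 2 * M * (ε / (3 * (2 * M + 1)) * N) = (ε / 3 * N) * (2 * M / (2 * M + 1)) := by
        field_simp
      rw [e]
      apply mul_le_of_le_one_right (by positivity)
      rw [div_le_one (by positivity)]; linarith
    linarith
  set T := N / l with hT
  obtain ⟨r, hr1, hr2⟩ : ∃ r, N = l * T + r ∧ r < l :=
    ⟨N % l, (Nat.div_add_mod N l).symm, Nat.mod_lt _ hl⟩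
  have h5 : |A N - A (l * T)| ≤ l * M := by
    rw [hr1]
    simp only [A]
    rw [Finset.sum_range_add, add_sub_cancel_left]
    refine (Finset.abs_sum_le_sum_abs _ _).trans ?_
    refine (Finset.sum_le_sum fun i _ => hg.1 _).trans ?_
    have : (r : ℝ) ≤ l := by exact_mod_cast hr2.le
    simp only [Finset.sum_const, Finset.card_range, nsmul_eq_mul]
    exact mul_le_mul_of_nonneg_right this hM
  have h6 := hJ T
  have h7 := sqrt_small T δ hδ0
  have h8 : |A (l * T) - l * (T * G)| ≤ ε / 3 * N + l * C1 * (1 / δ + 1) := by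
    rw [hA, ← mul_sub, abs_mul, abs_of_pos hl']
    have e : (l : ℝ) * T ≤ N := by
      have : l * T ≤ N := by omega
      exact_mod_cast this
    have hT0 : (0 : ℝ) ≤ T := by positivity
    have h9 : C1 * δ ≤ ε / 3 := by
      rw [hδ, show C1 * (ε / (3 * (C1 + 1))) = (ε / 3) * (C1 / (C1 + 1)) by field_simp]
      apply mul_le_of_le_one_right (by positivity)
      rw [div_le_one (by positivity)]; linarith
    calc (l : ℝ) * |∑ t ∈ Finset.range T, h (K (Nat.sqrt t)) - T * G|
        ≤ l * (C1 * (δ * T + 1 / δ + 1)) := by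
          apply mul_le_mul_of_nonneg_left _ hl'.le
          refine h6.trans ?_
          apply mul_le_mul_of_nonneg_left _ hC1
          linarith
      _ = (C1 * δ) * (l * T) + l * C1 * (1 / δ + 1) := by ring
      _ ≤ _ := by
        have := mul_le_mul h9 e (by positivity) (by positivity)
        linarith
  have h10 : |(l * (T * G) : ℝ) - N * G| ≤ l * |G| := by
    have e : (N : ℝ) = l * T + r := by exact_mod_cast hr1
    rw [e, show (l * (T * G) : ℝ) - (l * T + r) * G = -(r * G) by ring, abs_neg, abs_mul,
      Nat.abs_cast]
    have : (r : ℝ) ≤ l := by exact_mod_cast hr2.le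
    exact mul_le_mul_of_nonneg_right this hGM
  rw [abs_le] at h1 h5 h8 h10 ⊢
  constructor <;> linarith [h1.1, h1.2, h5.1, h5.2, h8.1, h8.2, h10.1, h10.2]

def Lf : ℕ → ℕ
  | 0 => 1
  | n + 1 => (n + 3) * Lf n

def Tf (n : ℕ) : ℕ := (n + 2) * Lf n

def Df (n : ℕ) : ℕ := (n + 1) * Lf n

theorem Lf_succ (n : ℕ) : Lf (n + 1) = Tf n + Lf n := by
  rw [Lf, Tf]; ring

theorem Tf_eq (n : ℕ) : Tf n = Lf n + Df n := by
  rw [Df, Tf]; ring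

theorem Lf_pos (n : ℕ) : 0 < Lf n := by
  induction n with
  | zero => simp [Lf]
  | succ n ih => rw [Lf]; positivity

theorem Lf_le_Df (n : ℕ) : Lf n ≤ Df n := by
  rw [Df]; exact Nat.le_mul_of_pos_left _ (Nat.succ_pos n)

theorem Lf_strictMono : StrictMono Lf := by
  apply strictMono_nat_of_lt_succ
  intro n
  rw [Lf_succ, Tf_eq]
  have := Lf_pos n
  have := Lf_le_Df n
  omega

theorem lt_Lf (n : ℕ) : n < Lf n := by
  induction n with
  | zero => simp [Lf]
  | succ n ih =>
    have : Lf n < Lf (n + 1) := Lf_strictMono (Nat.lt_succ_self n)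
    omega

theorem sq_le_Lf (n : ℕ) : n * n ≤ Lf n := by
  cases n with
  | zero => simp
  | succ n =>
    rw [Lf]
    have := lt_Lf n
    exact Nat.mul_le_mul (by omega) (by omega)

theorem Df_mono : Monotone Df := by
  intro a b h
  exact Nat.mul_le_mul (by omega) (Lf_strictMono.monotone h)

theorem Df_lt (n : ℕ) : Df n < Lf (n + 1) := by
  rw [Lf_succ, Tf_eq]
  have := Lf_pos n
  omega

def Wseq {k : ℕ} (V : ℕ → ℕ → Fin k) : ℕ → ℕ → Fin k
  | 0 => V 0
  | n + 1 => fun i => if i < Lf n then Wseq V n i else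
      if i < Tf n then V n (i - Lf n) else Wseq V n (i - Tf n)

def X {k : ℕ} (V : ℕ → ℕ → Fin k) (i : ℕ) : Fin k := Wseq V i i

theorem W_stable {k : ℕ} (V : ℕ → ℕ → Fin k) (n n' i : ℕ) (h : n ≤ n') (hi : i < Lf n) :
    Wseq V n' i = Wseq V n i := by
  induction n', h using Nat.le_induction with
  | base => rfl
  | succ n' hn ih =>
    rw [← ih]
    simp only [Wseq]
    rw [if_pos]
    exact lt_of_lt_of_le hi (Lf_strictMono.monotone hn)

theorem X_eq {k : ℕ} (V : ℕ → ℕ → Fin k) (n i : ℕ) (hi : i < Lf n) : X V i = Wseq V n i := by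
  unfold X
  rcases le_total i n with h | h
  · exact (W_stable V i n i h (lt_Lf i)).symm
  · exact W_stable V n i i h hi

theorem X_fill {k : ℕ} (V : ℕ → ℕ → Fin k) (n i : ℕ) (hi : i < Df n) :
    X V (Lf n + i) = V n i := by
  have h1 := Tf_eq n
  have h2 := Lf_succ n
  rw [X_eq V (n + 1) _ (by omega)]
  simp only [Wseq]
  rw [if_neg (by omega), if_pos (by omega)]
  congr 1; omega

theorem X_copy {k : ℕ} (V : ℕ → ℕ → Fin k) (n i : ℕ) (hi : i < Lf n) :
    X V (Tf n + i) = X V i := by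
  have h1 := Tf_eq n
  have h2 := Lf_succ n
  rw [X_eq V (n + 1) _ (by omega)]
  simp only [Wseq]
  rw [if_neg (by omega), if_neg (by omega), X_eq V n i hi]
  congr 1; omega

theorem X_recurrent {k : ℕ} (V : ℕ → ℕ → Fin k) : Recurrent (X V) := by
  intro ε hε
  obtain ⟨R, hR⟩ := exists_half_pow hε
  refine ⟨Tf R, ?_, ?_⟩
  · have := Tf_eq R
    have := Lf_pos R
    omega
  · show shiftDist (X V) (shift^[Tf R] (X V)) < ε
    refine lt_of_le_of_lt (sd_le (R := R) ?_) hR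
    intro i hi
    rw [shift_iter, X_copy]
    exact hi.trans (lt_Lf R)

def Piece {k : ℕ} (V : ℕ → ℕ → Fin k) (n s e : ℕ) : Prop :=
  ∃ m' r, n ≤ m' ∧ ∀ i, s + i < e → X V (s + i) = V m' (r + i)

theorem Piece.empty {k : ℕ} (V : ℕ → ℕ → Fin k) (n s : ℕ) : Piece V n s s :=
  ⟨n, 0, le_rfl, fun i hi => by omega⟩

theorem Piece.translate {k : ℕ} {V : ℕ → ℕ → Fin k} {n s e m : ℕ} (h : Piece V n s e)
    (he : e ≤ Lf m) : Piece V n (Tf m + s) (Tf m + e) := by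
  obtain ⟨m', r, h1, h2⟩ := h
  refine ⟨m', r, h1, fun i hi => ?_⟩
  rw [← h2 i (by omega), add_assoc, X_copy]
  omega

theorem Piece.filler {k : ℕ} (V : ℕ → ℕ → Fin k) (n m s e : ℕ) (hn : n ≤ m) (hs : Lf m ≤ s)
    (he : e ≤ Tf m) : Piece V n s e := by
  refine ⟨m, s - Lf m, hn, fun i hi => ?_⟩
  have h1 := Tf_eq m
  rw [← X_fill V m (s - Lf m + i) (by omega)]
  congr 1; omega

theorem suf_struct {k : ℕ} (V : ℕ → ℕ → Fin k) (n m : ℕ) (h : n ≤ m) :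
    ∀ a ≤ Lf m, Lf m ≤ a + Df n → ∃ p, a ≤ p ∧ p ≤ Lf m ∧ Lf m ≤ p + Lf n ∧ Piece V n a p := by
  induction m, h using Nat.le_induction with
  | base =>
    intro a ha _
    exact ⟨a, le_rfl, ha, by omega, Piece.empty V n a⟩
  | succ m hn ih =>
    intro a ha hD
    have h1 := Tf_eq m
    have h2 := Lf_succ m
    have h3 := Df_mono hn
    by_cases hT : Tf m ≤ a
    · obtain ⟨p, p1, p2, p3, p4⟩ := ih (a - Tf m) (by omega) (by omega)
      refine ⟨Tf m + p, by omega, by omega, by omega, ?_⟩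
      have := p4.translate p2
      rwa [show Tf m + (a - Tf m) = a by omega] at this
    · have : m = n := by
        by_contra hne
        have h4 : Lf (n + 1) ≤ Lf m := Lf_strictMono.monotone (by omega)
        have h5 := Df_lt n
        omega
      subst this
      exact ⟨Tf m, by omega, by omega, by omega, Piece.filler V m m a (Tf m) le_rfl (by omega) le_rfl⟩

theorem int_struct {k : ℕ} (V : ℕ → ℕ → Fin k) (n m : ℕ) (h : n ≤ m) :
    ∀ a b, a ≤ b → b ≤ Lf m → b ≤ a + Df n → ∃ p q, a ≤ p ∧ p ≤ q ∧ q ≤ b ∧ q ≤ p + Lf n ∧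
      Piece V n a p ∧ Piece V n q b := by
  induction m, h using Nat.le_induction with
  | base =>
    intro a b hab hb _
    exact ⟨a, b, le_rfl, hab, le_rfl, by omega, Piece.empty V n a, Piece.empty V n b⟩
  | succ m hn ih =>
    intro a b hab hb hD
    have h1 := Tf_eq m
    have h2 := Lf_succ m
    have h3 := Df_mono hn
    by_cases c1 : b ≤ Lf m
    · exact ih a b hab c1 hD
    by_cases c2 : Tf m ≤ a
    · obtain ⟨p, q, p1, p2, p3, p4, p5, p6⟩ := ih (a - Tf m) (b - Tf m) (by omega) (by omega) (by omega)
      refine ⟨Tf m + p, Tf m + q, by omega, by omega, by omega, by omega, ?_, ?_⟩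
      · have := p5.translate (m := m) (by omega)
        rwa [show Tf m + (a - Tf m) = a by omega] at this
      · have := p6.translate (m := m) (by omega)
        rwa [show Tf m + (b - Tf m) = b by omega] at this
    by_cases c3 : a < Lf m
    · obtain ⟨p, p1, p2, p3, p4⟩ := suf_struct V n m hn a c3.le (by omega)
      exact ⟨p, Lf m, p1, p2, by omega, by omega, p4,
        Piece.filler V n m _ _ hn le_rfl (by omega)⟩
    by_cases c4 : b ≤ Tf m
    · exact ⟨a, a, le_rfl, le_rfl, hab, by omega, Piece.empty V n a,
        Piece.filler V n m _ _ hn (by omega) c4⟩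
    · -- filler followed by a prefix of the copy
      have hTn := Tf_eq n
      have hle : Lf n ≤ Lf m := Lf_strictMono.monotone hn
      refine ⟨Tf m, min (Tf m + Lf n) b, by omega, by omega, by omega, by omega,
        Piece.filler V n m _ _ hn (by omega) le_rfl, ?_⟩
      by_cases c5 : Tf m + Lf n ≤ b
      · rw [min_eq_left c5]
        have := (Piece.filler V n n (Lf n) (b - Tf m) le_rfl le_rfl (by omega)).translate
          (m := m) (by omega)
        rwa [show Tf m + (b - Tf m) = b by omega] at this
      · rw [min_eq_right (by omega)]
        exact Piece.empty V n b

theorem piece_cnt {k m : ℕ} (U : Fin m → ℕ → Fin k) (V : ℕ → ℕ → Fin k) (R : ℕ) (ε C : ℝ)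
    (hε : 0 ≤ ε) (hC : 0 ≤ C)
    (hV : ∀ n a N : ℕ, (cnt (Bad U R (V n)) a N : ℝ) ≤ ε * N + C) (n s N : ℕ)
    (hp : Piece V n s (s + N)) : (cnt (Bad U R (X V)) s N : ℝ) ≤ ε * N + C + R := by
  by_cases hN : N ≤ R
  · have h1 : (cnt (Bad U R (X V)) s N : ℝ) ≤ N := by exact_mod_cast cnt_le _ _ _
    have h2 : (N : ℝ) ≤ R := by exact_mod_cast hN
    have : 0 ≤ ε * N := by positivity
    linarith
  · obtain ⟨m', r, _, h2⟩ := hp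
    have e : N = (N - R) + R := by omega
    have h3 : cnt (Bad U R (X V)) s N ≤ cnt (Bad U R (X V)) s (N - R) + R := by
      conv_lhs => rw [e]
      rw [cnt_split]
      have := cnt_le (Bad U R (X V)) (s + (N - R)) R
      omega
    have h4 : cnt (Bad U R (X V)) s (N - R) ≤ cnt (Bad U R (V m')) r (N - R) := by
      apply cnt_translate
      intro i hi hb j t hj
      refine hb j t (agr.trans' ?_ hj)
      intro w hw
      rw [shift_iter, shift_iter, add_assoc, add_assoc]
      exact h2 _ (by omega)
    have h5 := hV m' r (N - R)
    have h6 : ((N - R : ℕ) : ℝ) ≤ N := by exact_mod_cast Nat.sub_le N R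
    have h7 : (cnt (Bad U R (X V)) s N : ℝ) ≤ cnt (Bad U R (V m')) r (N - R) + R := by
      exact_mod_cast h3.trans (by omega)
    have h8 := mul_le_mul_of_nonneg_left h6 hε
    linarith

theorem X_bad {k m : ℕ} (U : Fin m → ℕ → Fin k) (V : ℕ → ℕ → Fin k) (R : ℕ)
    (hV : ∀ ε > (0 : ℝ), ∃ C : ℝ, 0 ≤ C ∧ ∀ n a N : ℕ, (cnt (Bad U R (V n)) a N : ℝ) ≤ ε * N + C) :
    SmallB (Bad U R (X V)) := by
  intro ε hε
  obtain ⟨C, hC, hV⟩ := hV (ε / 4) (by positivity)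
  obtain ⟨n, hn⟩ := exists_nat_gt ((2 * (C + R) + 1) * 4 / ε + 4 / ε)
  have hn0 : (0 : ℝ) < n := lt_of_le_of_lt (by positivity) hn
  have hDpos : 0 < Df n := lt_of_lt_of_le (Lf_pos n) (Lf_le_Df n)
  -- bound on short windows
  have hshort : ∀ a, ∀ N ≤ Df n, (cnt (Bad U R (X V)) a N : ℝ) ≤
      Lf n + ε / 4 * Df n + 2 * (C + R) := by
    intro a N hN
    obtain ⟨p, q, h1, h2, h3, h4, h5, h6⟩ := int_struct V n (n + (a + N)) (by omega) a (a + N)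
      (by omega) (by have := lt_Lf (n + (a + N)); omega) (by omega)
    have e : N = (p - a) + ((q - p) + (a + N - q)) := by omega
    have b1 := piece_cnt U V R (ε / 4) C (by positivity) hC hV n a (p - a)
      (by rwa [show a + (p - a) = p by omega])
    have b3 := piece_cnt U V R (ε / 4) C (by positivity) hC hV n q (a + N - q)
      (by rwa [show q + (a + N - q) = a + N by omega])
    have b2 : (cnt (Bad U R (X V)) p (q - p) : ℝ) ≤ Lf n := by
      have := cnt_le (Bad U R (X V)) p (q - p)
      have : cnt (Bad U R (X V)) p (q - p) ≤ Lf n := by omega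
      exact_mod_cast this
    have b4 : cnt (Bad U R (X V)) a N = cnt (Bad U R (X V)) a (p - a) +
        (cnt (Bad U R (X V)) p (q - p) + cnt (Bad U R (X V)) q (a + N - q)) := by
      conv_lhs => rw [e]
      rw [cnt_split, cnt_split]
      rw [show a + (p - a) = p by omega, show p + (q - p) = q by omega]
    rw [b4]
    push_cast
    have b5 : ((p - a : ℕ) : ℝ) + ((a + N - q : ℕ) : ℝ) ≤ Df n := by
      have : (p - a) + (a + N - q) ≤ Df n := by omega
      exact_mod_cast this
    have b6 := mul_le_mul_of_nonneg_left b5 (show 0 ≤ ε / 4 by positivity)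
    linarith
  set κ : ℕ := ⌊(Lf n + ε / 4 * Df n + 2 * (C + R) : ℝ)⌋₊ with hκ
  have hκ1 : ∀ a, ∀ N ≤ Df n, cnt (Bad U R (X V)) a N ≤ κ :=
    fun a N hN => Nat.le_floor (hshort a N hN)
  have hκ2 : (κ : ℝ) ≤ Lf n + ε / 4 * Df n + 2 * (C + R) := Nat.floor_le (by positivity)
  have hκ3 : (κ : ℝ) ≤ ε * Df n := by
    have hL : (1 : ℝ) ≤ Lf n := by exact_mod_cast Lf_pos n
    have hD : (Df n : ℝ) = (n + 1) * Lf n := by simp [Df]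
    have h1 : (Lf n : ℝ) ≤ ε / 4 * Df n := by
      rw [hD]
      have : 4 / ε < n := lt_of_le_of_lt (le_add_of_nonneg_left (by positivity)) hn
      rw [div_lt_iff₀ hε] at this
      nlinarith
    have h2 : 2 * (C + R) ≤ ε / 4 * Df n := by
      rw [hD]
      have : (2 * (C + R) + 1) * 4 / ε < n :=
        lt_of_le_of_lt (le_add_of_nonneg_right (by positivity)) hn
      rw [div_lt_iff₀ hε] at this
      have h3 : ε / 4 * (n : ℝ) ≤ ε / 4 * ((n + 1) * Lf n) := by
        apply mul_le_mul_of_nonneg_left _ (by positivity)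
        nlinarith
      linarith
    have : 0 ≤ ε * Df n := by positivity
    linarith
  refine ⟨κ, by positivity, fun a N => ?_⟩
  have h1 := cnt_chunk _ (Df n) κ hDpos hκ1 a N
  have h2 : (cnt (Bad U R (X V)) a N : ℝ) ≤ (((N / Df n : ℕ) : ℝ) + 1) * κ := by exact_mod_cast h1
  have h3 : ((N / Df n : ℕ) : ℝ) * Df n ≤ N := by exact_mod_cast Nat.div_mul_le_self N (Df n)
  have h4 : ((N / Df n : ℕ) : ℝ) * κ ≤ ((N / Df n : ℕ) : ℝ) * (ε * Df n) :=
    mul_le_mul_of_nonneg_left hκ3 (by positivity)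
  nlinarith

def Vs {k m : ℕ} (U : Fin m → ℕ → Fin k) (e : ℕ → Fin m) (Y : ℕ → ℕ → Fin k) (b : ℕ → ℕ)
    (n p : ℕ) : Fin k := if p < n then U (e n) p else Y n (p - n + b n)

theorem Vs_tail {k m : ℕ} (U : Fin m → ℕ → Fin k) (e : ℕ → Fin m) (Y : ℕ → ℕ → Fin k) (b : ℕ → ℕ)
    (n : ℕ) : shift^[n] (Vs U e Y b n) = shift^[b n] (Y n) := by
  funext i
  rw [shift_iter, shift_iter, Vs, if_neg (by omega)]
  congr 1; omega

theorem Vs_avg {k m : ℕ} (U : Fin m → ℕ → Fin k) (e : ℕ → Fin m) (Y : ℕ → ℕ → Fin k) (b : ℕ → ℕ)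
    (hb : ∀ n, b n ≤ 1) (g : (ℕ → Fin k) → ℝ) (M : ℝ) (hM : 0 ≤ M) (hg : Reg g M) (G : ℕ → ℝ)
    (hG : ∀ n, |G n| ≤ M)
    (hY : ∀ ε > (0 : ℝ), ∃ C : ℝ, 0 ≤ C ∧ ∀ n N : ℕ, |bs g (Y n) N - N * G n| ≤ ε * N + C) :
    ∀ ε > (0 : ℝ), ∃ C : ℝ, 0 ≤ C ∧ ∀ n N : ℕ,
      |bs g (Vs U e Y b n) N - N * G n| ≤ ε * N + C + 2 * M * n := by
  intro ε hε
  obtain ⟨C, hC, h⟩ := hY ε hε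
  refine ⟨C + ε + 2 * M, by positivity, fun n N => ?_⟩
  have hNG : ∀ N : ℕ, |N * G n| ≤ M * N := fun N => by
    rw [abs_mul, Nat.abs_cast, mul_comm]
    exact mul_le_mul_of_nonneg_right (hG n) (by positivity)
  rcases le_total N n with hN | hN
  · have h1 := bs_abs_le hg (Vs U e Y b n) N
    have h2 := hNG N
    have h3 : (N : ℝ) ≤ n := by exact_mod_cast hN
    have h4 := mul_le_mul_of_nonneg_left h3 hM
    have h5 := abs_sub (bs g (Vs U e Y b n) N) (N * G n)
    have : 0 ≤ ε * N := by positivity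
    linarith
  · obtain ⟨N', rfl⟩ := Nat.exists_eq_add_of_le hN
    rw [bs_add, Vs_tail]
    have h0 := bs_add g (Y n) (b n) N'
    have h1 := h n (b n + N')
    have h2 := bs_abs_le hg (Vs U e Y b n) n
    have h3 := bs_abs_le hg (Y n) (b n)
    have h4 := hNG n
    have h5 := hNG (b n)
    have hb1 : (b n : ℝ) ≤ 1 := by exact_mod_cast hb n
    have h6 : M * b n ≤ M := by nlinarith
    have h7 : ε * b n ≤ ε := by nlinarith
    have h8 : 0 ≤ ε * n := by positivity
    rw [h0] at h1
    push_cast at *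
    rw [abs_le] at *
    constructor <;> nlinarith

theorem X_seg {k : ℕ} (V : ℕ → ℕ → Fin k) (g : (ℕ → Fin k) → ℝ) (M : ℝ) (hg : Reg g M) (G : ℕ → ℝ)
    (hV : ∀ ε > (0 : ℝ), ∃ C : ℝ, 0 ≤ C ∧ ∀ n N : ℕ,
      |bs g (V n) N - N * G n| ≤ ε * N + C + 2 * M * n) :
    ∀ ε > (0 : ℝ), ∃ C : ℝ, 0 ≤ C ∧ ∀ n N : ℕ, N ≤ Df n →
      |bs g (shift^[Lf n] (X V)) N - N * G n| ≤ ε * N + C + 2 * M * n := by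
  intro ε hε
  obtain ⟨C, hC, h⟩ := hV (ε / 2) (by positivity)
  obtain ⟨C', hC', h'⟩ := bs_transfer hg (ε / 2) (by positivity)
  refine ⟨C + C', by positivity, fun n N hN => ?_⟩
  have h1 := h n N
  have h2 := h' (shift^[Lf n] (X V)) (V n) N (fun i hi => by
    rw [shift_iter, X_fill]; omega)
  rw [abs_le] at *
  constructor <;> linarith

theorem lin_dom (A ε : ℝ) (hε : 0 < ε) : ∃ n0 : ℕ, ∀ n ≥ n0, A ≤ ε * n := by
  obtain ⟨n0, hn0⟩ := exists_nat_gt (A / ε)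
  refine ⟨n0, fun n hn => ?_⟩
  rw [div_lt_iff₀ hε] at hn0
  have : (n0 : ℝ) ≤ n := by exact_mod_cast hn
  nlinarith

theorem X_Tf {k : ℕ} (V : ℕ → ℕ → Fin k) (g : (ℕ → Fin k) → ℝ) (M : ℝ) (hM : 0 ≤ M) (hg : Reg g M)
    (G : ℕ → ℝ) (hG : ∀ n, |G n| ≤ M)
    (hV : ∀ ε > (0 : ℝ), ∃ C : ℝ, 0 ≤ C ∧ ∀ n N : ℕ,
      |bs g (V n) N - N * G n| ≤ ε * N + C + 2 * M * n) (ε : ℝ) (hε : 0 < ε) :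
    ∃ n0 : ℕ, ∀ n ≥ n0, |bs g (X V) (Tf n) - Tf n * G n| ≤ ε * Tf n := by
  obtain ⟨C, hC, h⟩ := X_seg V g M hg G hV (ε / 2) (by positivity)
  obtain ⟨n0, hn0⟩ := lin_dom (C + 4 * M) (ε / 2) (by positivity)
  refine ⟨n0, fun n hn => ?_⟩
  have h1 := h n (Df n) le_rfl
  have h2 := bs_abs_le hg (X V) (Lf n)
  have h3 := hn0 n hn
  have h4 : (n : ℝ) ≤ Lf n := by exact_mod_cast (lt_Lf n).le
  have h5 : (1 : ℝ) ≤ Lf n := by exact_mod_cast Lf_pos n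
  have h6 : |(Lf n : ℝ) * G n| ≤ M * Lf n := by
    rw [abs_mul, Nat.abs_cast, mul_comm]
    exact mul_le_mul_of_nonneg_right (hG n) (by positivity)
  have h7 : (Df n : ℝ) = (n + 1) * Lf n := by simp [Df]
  have h8 : 2 * M * n ≤ 2 * M * Lf n := mul_le_mul_of_nonneg_left h4 (by positivity)
  have h9 : C ≤ C * Lf n := le_mul_of_one_le_right hC h5
  have h10 : (C + 4 * M) * Lf n ≤ ε / 2 * n * Lf n := mul_le_mul_of_nonneg_right h3 (by positivity)
  have h11 : ε / 2 * n * Lf n ≤ ε / 2 * Df n := by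
    rw [h7, mul_assoc]
    apply mul_le_mul_of_nonneg_left _ (by positivity)
    nlinarith
  have h12 : 0 ≤ ε * Lf n := by positivity
  rw [Tf_eq, bs_add]
  push_cast
  rw [abs_le] at *
  constructor <;> linarith

theorem X_lower {k : ℕ} (V : ℕ → ℕ → Fin k) (g : (ℕ → Fin k) → ℝ) (M : ℝ) (hM : 0 ≤ M)
    (hg : Reg g M) (G : ℕ → ℝ) (hG : ∀ n, |G n| ≤ M)
    (hV : ∀ ε > (0 : ℝ), ∃ C : ℝ, 0 ≤ C ∧ ∀ n N : ℕ,
      |bs g (V n) N - N * G n| ≤ ε * N + C + 2 * M * n) (γ : ℝ) (hγ : ∀ n, γ ≤ G n)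
    (ε : ℝ) (hε : 0 < ε) :
    ∃ N0 : ℕ, ∀ N ≥ N0, (γ - ε) * N ≤ bs g (X V) N := by
  obtain ⟨C, hC, h⟩ := X_seg V g M hg G hV (ε / 4) (by positivity)
  obtain ⟨n1, hn1⟩ := X_Tf V g M hM hg G hG hV (ε / 4) (by positivity)
  obtain ⟨n2, hn2⟩ := lin_dom (C + 2 * M) (ε / 4) (by positivity)
  have hγM : γ ≤ M := (hγ 0).trans ((le_abs_self _).trans (hG 0))
  -- at times `Tf n`
  have hT : ∀ n ≥ n1, γ * Tf n - ε / 4 * Tf n ≤ bs g (X V) (Tf n) := by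
    intro n hn
    have h1 := (abs_le.1 (hn1 n hn)).1
    have h2 : (Tf n : ℝ) * γ ≤ Tf n * G n := mul_le_mul_of_nonneg_left (hγ n) (by positivity)
    linarith
  -- just after `Tf n`
  have hT2 : ∀ n ≥ n1 + n2, ∀ N' ≤ Lf n, γ * (Tf n + N' : ℕ) - ε / 2 * (Tf n + N' : ℕ) ≤
      bs g (X V) (Tf n + N') := by
    intro n hn N' hN'
    have h1 := hT n (by omega)
    have h2 := (abs_le.1 (bs_abs_le hg (shift^[Tf n] (X V)) N')).1
    have h3 := hn2 n (by omega)
    have h4 : (N' : ℝ) ≤ Lf n := by exact_mod_cast hN'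
    have h5 : (Tf n : ℝ) = (n + 2) * Lf n := by simp [Tf]
    have h6 : 2 * M * N' ≤ 2 * M * Lf n := mul_le_mul_of_nonneg_left h4 (by positivity)
    have h7 : (2 * M) * Lf n ≤ ε / 4 * n * Lf n :=
      mul_le_mul_of_nonneg_right (by linarith) (by positivity)
    have h8 : ε / 4 * n * Lf n ≤ ε / 4 * Tf n := by
      rw [h5, mul_assoc]
      apply mul_le_mul_of_nonneg_left _ (by positivity)
      nlinarith [Nat.cast_nonneg (α := ℝ) (Lf n)]
    have h9 : γ * N' ≤ M * N' := mul_le_mul_of_nonneg_right hγM (by positivity)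
    have h10 : 0 ≤ ε * N' := by positivity
    rw [bs_add]
    push_cast
    linarith
  refine ⟨Lf (n1 + n2 + 1), fun N hN => ?_⟩
  -- locate N
  obtain ⟨n, hn, hnl, hnu⟩ : ∃ n, n1 + n2 ≤ n ∧ Lf (n + 1) ≤ N ∧ N < Lf (n + 2) := by
    have hex : ∃ j, N < Lf j := ⟨N, lt_Lf N⟩
    classical
    have h1 := Nat.find_spec hex
    have h2 : n1 + n2 + 1 < Nat.find hex := by
      by_contra hc
      have := Lf_strictMono.monotone (not_lt.1 hc)
      omega
    refine ⟨Nat.find hex - 2, by omega, ?_, ?_⟩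
    · have := Nat.find_min hex (m := Nat.find hex - 2 + 1) (by omega)
      omega
    · rwa [show Nat.find hex - 2 + 2 = Nat.find hex by omega]
  have hN0 : (0 : ℝ) ≤ ε * N := by positivity
  have e1 := Tf_eq (n + 1)
  have e2 : Lf (n + 2) = Tf (n + 1) + Lf (n + 1) := Lf_succ (n + 1)
  by_cases hc : N ≤ Tf (n + 1)
  · obtain ⟨N', rfl⟩ := Nat.exists_eq_add_of_le hnl
    have h1 := hT2 n hn (Lf n) le_rfl
    rw [← Lf_succ] at h1
    have h2 := (abs_le.1 (h (n + 1) N' (by omega))).1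
    have h3 := hn2 (n + 1) (by omega)
    have h4 : (N' : ℝ) * γ ≤ N' * G (n + 1) := mul_le_mul_of_nonneg_left (hγ _) (by positivity)
    have h5 : (((n + 1 : ℕ) : ℝ)) * ((n + 1 : ℕ) : ℝ) ≤ Lf (n + 1) := by
      exact_mod_cast sq_le_Lf (n + 1)
    have h6 : (1 : ℝ) ≤ ((n + 1 : ℕ) : ℝ) := by push_cast; linarith [Nat.cast_nonneg (α := ℝ) n]
    have h7 : C + 2 * M * ((n + 1 : ℕ) : ℝ) ≤ ε / 4 * Lf (n + 1) := by
      have q1 : C ≤ C * ((n + 1 : ℕ) : ℝ) := le_mul_of_one_le_right hC h6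
      have q2 : (C + 2 * M) * ((n + 1 : ℕ) : ℝ) ≤ ε / 4 * ((n + 1 : ℕ) : ℝ) * ((n + 1 : ℕ) : ℝ) :=
        mul_le_mul_of_nonneg_right h3 (by positivity)
      have q3 := mul_le_mul_of_nonneg_left h5 (show 0 ≤ ε / 4 by positivity)
      linarith
    rw [bs_add]
    have h8 : 0 ≤ ε * Lf (n + 1) := by positivity
    have h9 : 0 ≤ ε * N' := by positivity
    push_cast at *
    linarith
  · obtain ⟨N', rfl⟩ := Nat.exists_eq_add_of_le (not_le.1 hc).le
    have h1 := hT2 (n + 1) (by omega) N' (by omega)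
    linarith

theorem X_upper {k : ℕ} (V : ℕ → ℕ → Fin k) (g : (ℕ → Fin k) → ℝ) (M : ℝ) (hM : 0 ≤ M)
    (hg : Reg g M) (G : ℕ → ℝ) (hG : ∀ n, |G n| ≤ M)
    (hV : ∀ ε > (0 : ℝ), ∃ C : ℝ, 0 ≤ C ∧ ∀ n N : ℕ,
      |bs g (V n) N - N * G n| ≤ ε * N + C + 2 * M * n) (γ : ℝ) (hγ : ∀ n, G n ≤ γ)
    (ε : ℝ) (hε : 0 < ε) :
    ∃ N0 : ℕ, ∀ N ≥ N0, bs g (X V) N ≤ (γ + ε) * N := by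
  obtain ⟨N0, h⟩ := X_lower V (fun z => - g z) M hM hg.neg (fun n => - G n)
    (fun n => by rw [abs_neg]; exact hG n) (fun ε hε => by
      obtain ⟨C, hC, h⟩ := hV ε hε
      refine ⟨C, hC, fun n N => ?_⟩
      rw [bs_neg]
      have := h n N
      rw [← abs_neg] at this
      convert this using 2; ring) (-γ) (fun n => neg_le_neg (hγ n)) ε hε
  refine ⟨N0, fun N hN => ?_⟩
  have := h N hN
  rw [bs_neg] at this
  linarith

theorem Bad_shift_cnt {k m : ℕ} (U : Fin m → ℕ → Fin k) (R a N b : ℕ) (z : ℕ → Fin k) :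
    cnt (Bad U R (shift^[b] z)) a N ≤ cnt (Bad U R z) (b + a) N := by
  apply cnt_translate
  intro i hi h j s hj
  refine h j s ?_
  rw [← Function.iterate_add_apply]
  rwa [show a + i + b = b + a + i by omega]

theorem Vs_bad {k m : ℕ} (U : Fin m → ℕ → Fin k) (e : ℕ → Fin m) (Y : ℕ → ℕ → Fin k) (b : ℕ → ℕ)
    (l R : ℕ) (hl : 0 < l) (hY : ∀ n, Bad U R (Y n) ⊆ SqSet l R) :
    ∀ ε > (0 : ℝ), ∃ C : ℝ, 0 ≤ C ∧ ∀ n a N : ℕ,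
      (cnt (Bad U R (Vs U e Y b n)) a N : ℝ) ≤ ε * N + C := by
  intro ε hε
  obtain ⟨C, hC, h⟩ := sq_small l R hl ε hε
  refine ⟨C + R, by positivity, fun n a N => ?_⟩
  -- windows right of n
  have hr : ∀ a N, n ≤ a → (cnt (Bad U R (Vs U e Y b n)) a N : ℝ) ≤ ε * N + C := by
    intro a N ha
    have h1 : cnt (Bad U R (Vs U e Y b n)) a N ≤ cnt (SqSet l R) (b n + (a - n)) N := by
      refine le_trans ?_ ((Bad_shift_cnt U R (a - n) N (b n) (Y n)).trans (cnt_mono (hY n) _ _))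
      rw [← Vs_tail U e Y b n]
      apply cnt_translate
      intro i hi h j s hj
      refine h j s ?_
      rw [← Function.iterate_add_apply] at hj
      rwa [show a - n + i + n = a + i by omega] at hj
    have h2 := h (b n + (a - n)) N
    have h3 : (cnt (Bad U R (Vs U e Y b n)) a N : ℝ) ≤ cnt (SqSet l R) (b n + (a - n)) N := by
      exact_mod_cast h1
    linarith
  -- no bad positions before n - R
  have hlft : ∀ a N, a + N + R ≤ n → cnt (Bad U R (Vs U e Y b n)) a N = 0 := by
    intro a N haN
    have : cnt (Bad U R (Vs U e Y b n)) a N ≤ cnt ∅ a N := by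
      apply cnt_translate
      intro i hi hb
      refine absurd ?_ (hb (e n) (a + i))
      intro w hw
      rw [shift_iter, shift_iter, Vs, if_pos (by omega)]
    have h0 : cnt ∅ a N = 0 := by rw [← cnt_eq_ncard]; simp
    omega
  -- split
  set N1 := min N (n - R - a) with hN1
  set N2 := min (N - N1) (n - (a + N1)) with hN2
  have hN2R : n - R ≤ a + N1 ∨ N = N1 := by omega
  have eN : N = N1 + (N2 + (N - N1 - N2)) := by omega
  have hs : cnt (Bad U R (Vs U e Y b n)) a N = cnt (Bad U R (Vs U e Y b n)) a N1 +
    (cnt (Bad U R (Vs U e Y b n)) (a + N1) N2 +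
      cnt (Bad U R (Vs U e Y b n)) (a + N1 + N2) (N - N1 - N2)) := by
    conv_lhs => rw [eN]
    rw [cnt_split, cnt_split]
  have p1 : cnt (Bad U R (Vs U e Y b n)) a N1 = 0 := by
    by_cases h0 : N1 = 0
    · rw [h0]; have := cnt_le (Bad U R (Vs U e Y b n)) a 0; omega
    · exact hlft a N1 (by omega)
  have p2 : cnt (Bad U R (Vs U e Y b n)) (a + N1) N2 ≤ R := by
    refine (cnt_le _ _ _).trans ?_
    omega
  have p3 : (cnt (Bad U R (Vs U e Y b n)) (a + N1 + N2) (N - N1 - N2) : ℝ) ≤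
      ε * (N - N1 - N2 : ℕ) + C := by
    by_cases h0 : N - N1 - N2 = 0
    · rw [h0]
      have := cnt_le (Bad U R (Vs U e Y b n)) (a + N1 + N2) 0
      rw [Nat.le_zero.1 this]; simp [hC]
    · exact hr _ _ (by omega)
  rw [hs, p1]
  have p2' : (cnt (Bad U R (Vs U e Y b n)) (a + N1) N2 : ℝ) ≤ R := by exact_mod_cast p2
  have p4 : ((N - N1 - N2 : ℕ) : ℝ) ≤ N := by exact_mod_cast (by omega)
  have p5 := mul_le_mul_of_nonneg_left p4 hε.le
  push_cast
  linarith

structure Sys (k m : ℕ) where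
  U : Fin m → ℕ → Fin k
  l : ℕ
  hl : 0 < l
  hper : ∀ j i, U j (i + l) = U j i
  hdisj : ∀ j j', j ≠ j' → ∀ s s', shift^[s] (U j) ≠ shift^[s'] (U j')
  hnc : ∀ j, ∃ i, i + 1 < l ∧ U j i ≠ U j (i + 1)
  c : Bool → Fin m → ℝ
  c0 : ∀ t j, 0 ≤ c t j
  c1 : ∀ t, ∑ j, c t j = 1
  K : Bool → ℕ → Fin m
  hK : ∀ (t : Bool) (Q : ℕ) (j : Fin m),
    |∑ q ∈ Finset.range Q, (2 * (q : ℝ) + 1) * (if K t q = j then 1 else 0) - c t j * (Q : ℝ) ^ 2|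
      ≤ m * (2 * Q + 1)
  e : ℕ → Fin m
  he : ∀ j n0, ∃ n ≥ n0, e n = j

namespace Sys
variable {k m : ℕ} (S : Sys k m)

def Y (n : ℕ) : ℕ → Fin k := Yseq S.U S.l (S.K n.bodd)

def V (b : ℕ → ℕ) : ℕ → ℕ → Fin k := Vs S.U S.e S.Y b

def x (b : ℕ → ℕ) : ℕ → Fin k := X (S.V b)

noncomputable def G (g : (ℕ → Fin k) → ℝ) (t : Bool) : ℝ :=
  ∑ j, S.c t j * (bs g (S.U j) S.l / S.l)

theorem G_abs {g : (ℕ → Fin k) → ℝ} {M : ℝ} (hg : Reg g M) (t : Bool) : |S.G g t| ≤ M := by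
  have hl : (0 : ℝ) < S.l := by exact_mod_cast S.hl
  unfold G
  refine (Finset.abs_sum_le_sum_abs _ _).trans ?_
  calc _ ≤ ∑ j, S.c t j * M := by
        apply Finset.sum_le_sum
        intro j _
        rw [abs_mul, abs_of_nonneg (S.c0 t j), abs_div, Nat.abs_cast]
        apply mul_le_mul_of_nonneg_left _ (S.c0 t j)
        rw [div_le_iff₀ hl]
        exact bs_abs_le hg _ _
    _ = M := by rw [← Finset.sum_mul, S.c1, one_mul]

theorem Y_unif {g : (ℕ → Fin k) → ℝ} {M : ℝ} (hg : Reg g M) :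
    ∀ ε > (0 : ℝ), ∃ C : ℝ, 0 ≤ C ∧ ∀ n N : ℕ, |bs g (S.Y n) N - N * S.G g n.bodd| ≤ ε * N + C := by
  intro ε hε
  have h := fun t => Y_avg S.U S.l S.hl S.hper (S.c t) (S.K t) (S.hK t) g M hg ε hε
  choose C hC h using h
  refine ⟨C true + C false, add_nonneg (hC _) (hC _), fun n N => ?_⟩
  have h1 := h n.bodd N
  have h2 : C n.bodd ≤ C true + C false := by
    have := hC true
    have := hC false
    cases n.bodd <;> linarith
  have h3 : |bs g (S.Y n) N - N * S.G g n.bodd| ≤ ε * N + C n.bodd := h1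
  linarith

theorem V_avg (b : ℕ → ℕ) (hb : ∀ n, b n ≤ 1) {g : (ℕ → Fin k) → ℝ} {M : ℝ} (hg : Reg g M) :
    ∀ ε > (0 : ℝ), ∃ C : ℝ, 0 ≤ C ∧ ∀ n N : ℕ,
      |bs g (S.V b n) N - N * S.G g n.bodd| ≤ ε * N + C + 2 * M * n :=
  Vs_avg S.U S.e S.Y b hb g M (hg.nonneg (S.x b)) hg (fun n => S.G g n.bodd)
    (fun n => S.G_abs hg _) (S.Y_unif hg)

theorem avgT (b : ℕ → ℕ) (hb : ∀ n, b n ≤ 1) {g : (ℕ → Fin k) → ℝ} {M : ℝ} (hg : Reg g M)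
    (ε : ℝ) (hε : 0 < ε) :
    ∃ n0 : ℕ, ∀ n ≥ n0, |bs g (S.x b) (Tf n) - Tf n * S.G g n.bodd| ≤ ε * Tf n :=
  X_Tf (S.V b) g M (hg.nonneg (S.x b)) hg (fun n => S.G g n.bodd)
    (fun n => S.G_abs hg _) (S.V_avg b hb hg) ε hε

theorem avgL (b : ℕ → ℕ) (hb : ∀ n, b n ≤ 1) {g : (ℕ → Fin k) → ℝ} {M : ℝ} (hg : Reg g M)
    (γ : ℝ) (hγ : ∀ t, γ ≤ S.G g t) (ε : ℝ) (hε : 0 < ε) :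
    ∃ N0 : ℕ, ∀ N ≥ N0, (γ - ε) * N ≤ bs g (S.x b) N :=
  X_lower (S.V b) g M (hg.nonneg (S.x b)) hg (fun n => S.G g n.bodd)
    (fun n => S.G_abs hg _) (S.V_avg b hb hg) γ (fun _ => hγ _) ε hε

theorem avgU (b : ℕ → ℕ) (hb : ∀ n, b n ≤ 1) {g : (ℕ → Fin k) → ℝ} {M : ℝ} (hg : Reg g M)
    (γ : ℝ) (hγ : ∀ t, S.G g t ≤ γ) (ε : ℝ) (hε : 0 < ε) :
    ∃ N0 : ℕ, ∀ N ≥ N0, bs g (S.x b) N ≤ (γ + ε) * N :=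
  X_upper (S.V b) g M (hg.nonneg (S.x b)) hg (fun n => S.G g n.bodd)
    (fun n => S.G_abs hg _) (S.V_avg b hb hg) γ (fun _ => hγ _) ε hε

theorem bad_small (b : ℕ → ℕ) (R : ℕ) : SmallB (Bad S.U R (S.x b)) :=
  X_bad S.U (S.V b) R (Vs_bad S.U S.e S.Y b S.l R S.hl fun n => Y_bad S.U S.l S.hl _ R)

theorem run (b : ℕ → ℕ) (n : ℕ) : agr n (shift^[Lf n] (S.x b)) (S.U (S.e n)) := by
  intro i hi
  have h1 := lt_Lf n
  have h2 := Lf_le_Df n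
  rw [shift_iter]
  unfold x
  rw [X_fill _ _ _ (by omega)]
  unfold V Vs
  rw [if_pos hi]

def Z (j : Fin m) : Set (ℕ → Fin k) := Set.range fun s => shift^[s] (S.U j)

theorem iter_mod (j : Fin m) (s : ℕ) : shift^[s] (S.U j) = shift^[s % S.l] (S.U j) := by
  conv_lhs => rw [← Nat.div_add_mod s S.l]
  exact per_iter (S.hper j) _ _

theorem sep1 (y : ℕ → Fin k) (j : Fin m) (hy : y ∉ S.Z j) :
    ∃ R, ∀ s, ¬ agr R y (shift^[s] (S.U j)) := by
  have h : ∀ s, ∃ i, y i ≠ shift^[s] (S.U j) i := by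
    intro s
    by_contra hc
    push Not at hc
    exact hy ⟨s, (funext hc).symm⟩
  choose f hf using h
  refine ⟨(Finset.range S.l).sup f + 1, fun s ha => ?_⟩
  rw [S.iter_mod] at ha
  refine hf (s % S.l) (ha _ ?_)
  have := Finset.le_sup (f := f) (Finset.mem_range.2 (Nat.mod_lt s S.hl))
  omega

theorem sep (y : ℕ → Fin k) : ∃ R, ∀ j, y ∉ S.Z j → ∀ s, ¬ agr R y (shift^[s] (S.U j)) := by
  have h : ∀ j, ∃ R, y ∉ S.Z j → ∀ s, ¬ agr R y (shift^[s] (S.U j)) := by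
    intro j
    by_cases hy : y ∈ S.Z j
    · exact ⟨0, fun h => absurd hy h⟩
    · obtain ⟨R, hR⟩ := S.sep1 y j hy
      exact ⟨R, fun _ => hR⟩
  choose f hf using h
  refine ⟨Finset.univ.sup f, fun j hy s ha => hf j hy s (ha.mono ?_)⟩
  exact Finset.le_sup (f := f) (Finset.mem_univ j)

theorem Z_disj {y : ℕ → Fin k} {j j' : Fin m} (h : y ∈ S.Z j) (h' : y ∈ S.Z j') : j = j' := by
  obtain ⟨s, rfl⟩ := h
  obtain ⟨s', h'⟩ := h'
  by_contra hne
  exact S.hdisj j j' hne s s' h'.symm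

theorem freq_ge (y : ℕ → Fin k) (j : Fin m) (hy : y ∈ S.Z j) (R : ℕ) :
    1 / (S.l : ℝ) ≤ bs (cyl R y) (S.U j) S.l / S.l := by
  obtain ⟨s, rfl⟩ := hy
  apply div_le_div_of_nonneg_right _ (by positivity)
  unfold bs
  have := Finset.single_le_sum (f := fun i => cyl R (shift^[s] (S.U j)) (shift^[i] (S.U j)))
    (fun i _ => by unfold cyl; split_ifs <;> norm_num) (Finset.mem_range.2 (Nat.mod_lt s S.hl))
  refine le_trans (le_of_eq ?_) this
  simp only [cyl]
  rw [if_pos]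
  show agr R (shift^[s] (S.U j)) _
  rw [S.iter_mod j s]
  exact fun i _ => rfl

theorem freq_zero (y : ℕ → Fin k) (j : Fin m) (R : ℕ)
    (h : ∀ s, ¬ agr R y (shift^[s] (S.U j))) : bs (cyl R y) (S.U j) S.l / S.l = 0 := by
  have : bs (cyl R y) (S.U j) S.l = 0 := by
    unfold bs
    apply Finset.sum_eq_zero
    intro i _
    simp only [cyl]
    rw [if_neg (h i)]
  rw [this, zero_div]

theorem freq_nonneg (y : ℕ → Fin k) (j : Fin m) (R : ℕ) :
    0 ≤ bs (cyl R y) (S.U j) S.l / S.l := by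
  apply div_nonneg _ (by positivity)
  unfold bs
  exact Finset.sum_nonneg (fun i _ => by unfold cyl; split_ifs <;> norm_num)

theorem G_ge (y : ℕ → Fin k) (j : Fin m) (hy : y ∈ S.Z j) (R : ℕ) (t : Bool) :
    S.c t j / S.l ≤ S.G (cyl R y) t := by
  unfold G
  have := Finset.single_le_sum (f := fun j => S.c t j * (bs (cyl R y) (S.U j) S.l / S.l))
    (fun i _ => mul_nonneg (S.c0 t i) (S.freq_nonneg y i R)) (Finset.mem_univ j)
  refine le_trans ?_ this
  rw [div_eq_mul_one_div]
  exact mul_le_mul_of_nonneg_left (S.freq_ge y j hy R) (S.c0 t j)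

theorem G_zero (y : ℕ → Fin k) (j : Fin m) (hy : y ∈ S.Z j) (R : ℕ)
    (hR : ∀ j, y ∉ S.Z j → ∀ s, ¬ agr R y (shift^[s] (S.U j))) (t : Bool) (hc : S.c t j = 0) :
    S.G (cyl R y) t = 0 := by
  unfold G
  apply Finset.sum_eq_zero
  intro i _
  by_cases h : i = j
  · subst h; rw [hc, zero_mul]
  · rw [S.freq_zero y i R (hR i fun hi => h (S.Z_disj hi hy)), mul_zero]

end Sys

theorem bd_le {f : ℕ → ℝ} (h1 : ∀ n, f n ≤ 1) : IsBoundedUnder (· ≤ ·) atTop f :=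
  ⟨1, by simp [h1]⟩
theorem bd_ge {f : ℕ → ℝ} (h0 : ∀ n, 0 ≤ f n) : IsBoundedUnder (· ≥ ·) atTop f :=
  ⟨0, by simp [h0]⟩

theorem li_ge {f : ℕ → ℝ} (h1 : ∀ n, f n ≤ 1) {δ : ℝ}
    (h : ∀ᶠ n in atTop, δ ≤ f n) : δ ≤ liminf f atTop :=
  le_liminf_of_le (bd_le h1).isCoboundedUnder_ge h

theorem li_le {f : ℕ → ℝ} (h0 : ∀ n, 0 ≤ f n) {δ : ℝ}
    (h : ∃ᶠ n in atTop, f n ≤ δ) : liminf f atTop ≤ δ :=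
  liminf_le_of_frequently_le h (bd_ge h0)

theorem ls_ge {f : ℕ → ℝ} (h1 : ∀ n, f n ≤ 1) {δ : ℝ}
    (h : ∃ᶠ n in atTop, δ ≤ f n) : δ ≤ limsup f atTop :=
  le_limsup_of_frequently_le h (bd_le h1)

theorem ls_le {f : ℕ → ℝ} (h0 : ∀ n, 0 ≤ f n) {δ : ℝ}
    (h : ∀ᶠ n in atTop, f n ≤ δ) : limsup f atTop ≤ δ :=
  limsup_le_of_le (bd_ge h0).isCoboundedUnder_le h

theorem Iio_cnt (S : Set ℕ) (n : ℕ) : (S ∩ Set.Iio n).ncard = cnt S 0 n := by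
  rw [← cnt_eq_ncard, zero_add]
  congr 2
  ext i; simp

theorem ratio_le (S : Set ℕ) (a N : ℕ) : (cnt S a N : ℝ) / N ≤ 1 :=
  div_le_one_of_le₀ (by exact_mod_cast cnt_le S a N) (by positivity)

theorem ratio_nonneg (S : Set ℕ) (a N : ℕ) : 0 ≤ (cnt S a N : ℝ) / N := by positivity

theorem ratio_ge {S : Set ℕ} {a N : ℕ} {δ : ℝ} (hN : 1 ≤ N) (h : δ * N ≤ cnt S a N) :
    δ ≤ (cnt S a N : ℝ) / N := by
  rw [le_div_iff₀ (by exact_mod_cast hN)]; exact h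

theorem ratio_le' {S : Set ℕ} {a N : ℕ} {δ : ℝ} (hδ : 0 ≤ δ) (h : cnt S a N ≤ δ * N) :
    (cnt S a N : ℝ) / N ≤ δ := div_le_of_le_mul₀ (by positivity) hδ h

theorem lower_pos {S : Set ℕ} {δ : ℝ} (hδ : 0 < δ)
    (h : ∀ᶠ N : ℕ in atTop, δ * N ≤ cnt S 0 N) : 0 < lowerDensity S := by
  unfold lowerDensity
  simp only [Iio_cnt]
  refine lt_of_lt_of_le hδ (li_ge (fun n => ratio_le S 0 n) ?_)
  filter_upwards [h, eventually_ge_atTop 1] with N h1 h2 using ratio_ge h2 h1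

theorem lower_not {S : Set ℕ}
    (h : ∀ δ > (0 : ℝ), ∃ᶠ N : ℕ in atTop, (cnt S 0 N : ℝ) ≤ δ * N) : ¬ 0 < lowerDensity S := by
  rw [not_lt]
  unfold lowerDensity
  simp only [Iio_cnt]
  refine le_of_forall_pos_le_add fun δ hδ => ?_
  rw [zero_add]
  exact li_le (fun n => ratio_nonneg S 0 n) ((h δ hδ).mono fun N h => ratio_le' hδ.le h)

theorem upper_pos {S : Set ℕ} {δ : ℝ} (hδ : 0 < δ)
    (h : ∃ᶠ N : ℕ in atTop, δ * N ≤ cnt S 0 N) : 0 < upperDensity S := by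
  unfold upperDensity
  simp only [Iio_cnt]
  refine lt_of_lt_of_le hδ (ls_ge (fun n => ratio_le S 0 n) ?_)
  exact (h.and_eventually (eventually_ge_atTop 1)).mono fun N h => ratio_ge h.2 h.1

theorem upper_not {S : Set ℕ}
    (h : ∀ δ > (0 : ℝ), ∀ᶠ N : ℕ in atTop, (cnt S 0 N : ℝ) ≤ δ * N) : ¬ 0 < upperDensity S := by
  rw [not_lt]
  unfold upperDensity
  simp only [Iio_cnt]
  refine le_of_forall_pos_le_add fun δ hδ => ?_
  rw [zero_add]
  exact ls_le (fun n => ratio_nonneg S 0 n) ((h δ hδ).mono fun N h => ratio_le' hδ.le h)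

theorem bupper_pos {S : Set ℕ} {δ : ℝ} (hδ : 0 < δ)
    (h : ∃ᶠ N : ℕ in atTop, ∃ a, δ * N ≤ cnt S a N) : 0 < banachUpperDensity S := by
  unfold banachUpperDensity
  simp only [cnt_eq_ncard]
  refine lt_of_lt_of_le hδ (ls_ge (fun n => ciSup_le fun a => ratio_le S a n) ?_)
  refine (h.and_eventually (eventually_ge_atTop 1)).mono fun N h => ?_
  obtain ⟨⟨a, ha⟩, h2⟩ := h
  exact (ratio_ge h2 ha).trans
    (le_ciSup (f := fun a => (cnt S a N : ℝ) / N) ⟨1, by rintro _ ⟨a, rfl⟩; exact ratio_le S a N⟩ a)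

theorem small_ev {S : Set ℕ} (h : SmallB S) (δ : ℝ) (hδ : 0 < δ) :
    ∀ᶠ N : ℕ in atTop, ∀ a, (cnt S a N : ℝ) ≤ δ * N := by
  obtain ⟨C, hC, h⟩ := h (δ / 2) (by positivity)
  obtain ⟨n0, hn0⟩ := lin_dom C (δ / 2) (by positivity)
  filter_upwards [eventually_ge_atTop n0] with N hN a
  have := h a N
  have := hn0 N hN
  linarith

theorem bupper_not {S : Set ℕ} (h : SmallB S) : ¬ 0 < banachUpperDensity S := by
  rw [not_lt]
  unfold banachUpperDensity
  simp only [cnt_eq_ncard]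
  refine le_of_forall_pos_le_add fun δ hδ => ?_
  rw [zero_add]
  refine ls_le (fun n => Real.iSup_nonneg fun a => ratio_nonneg S a n) ?_
  filter_upwards [small_ev h δ hδ] with N hN
  exact ciSup_le fun a => ratio_le' hδ.le (hN a)

theorem blower_not {S : Set ℕ}
    (h : ∃ᶠ N : ℕ in atTop, ∃ a, cnt S a N = 0) : ¬ 0 < banachLowerDensity S := by
  rw [not_lt]
  unfold banachLowerDensity
  simp only [cnt_eq_ncard]
  refine li_le (fun n => Real.iInf_nonneg fun a => ratio_nonneg S a n) (h.mono fun N hN => ?_)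
  obtain ⟨a, ha⟩ := hN
  refine (ciInf_le (f := fun a => (cnt S a N : ℝ) / N)
    ⟨0, by rintro _ ⟨a, rfl⟩; exact ratio_nonneg S a N⟩ a).trans ?_
  rw [ha]; simp

/-- times at which the orbit of `x` matches `y` to order `R` -/
def At {k : ℕ} (x y : ℕ → Fin k) (R : ℕ) : Set ℕ := {n | agr R y (shift^[n] x)}

theorem vis_sub {k : ℕ} (x y : ℕ → Fin k) (R : ℕ) : visits x (sball y ((1 / 2) ^ R)) ⊆ At x y R :=
  fun _ hn => agr_of_sd hn.2

theorem vis_cnt {k : ℕ} (x y : ℕ → Fin k) (R : ℕ) (ε : ℝ) (hR : (1 / 2 : ℝ) ^ R < ε) (a N : ℕ) :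
    cnt (At x y R) a N ≤ cnt (visits x (sball y ε)) a N + 1 := by
  cases N with
  | zero => have := cnt_le (At x y R) a 0; omega
  | succ N =>
    have h1 := cnt_split (At x y R) a 1 N
    have h2 := cnt_split (visits x (sball y ε)) a 1 N
    rw [add_comm 1 N] at h1 h2
    have h3 := cnt_le (At x y R) a 1
    have h4 : cnt (At x y R) (a + 1) N ≤ cnt (visits x (sball y ε)) (a + 1) N := by
      apply cnt_translate
      intro i _ h
      exact ⟨by omega, lt_of_le_of_lt (sd_le h) hR⟩
    omega

theorem vis_ge {k : ℕ} {x y : ℕ → Fin k} {R : ℕ} {ε : ℝ} (hR : (1 / 2 : ℝ) ^ R < ε) {δ : ℝ}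
    (hδ : 0 < δ) : ∀ᶠ N : ℕ in atTop, ∀ a, δ * N ≤ cnt (At x y R) a N →
      δ / 2 * N ≤ cnt (visits x (sball y ε)) a N := by
  obtain ⟨n0, hn0⟩ := lin_dom 1 (δ / 2) (by positivity)
  filter_upwards [eventually_ge_atTop n0] with N hN a h
  have h1 : (cnt (At x y R) a N : ℝ) ≤ cnt (visits x (sball y ε)) a N + 1 := by
    exact_mod_cast vis_cnt x y R ε hR a N
  have := hn0 N hN
  linarith

theorem mem_lower {k : ℕ} {x y : ℕ → Fin k}
    (h : ∀ R, ∃ δ > (0 : ℝ), ∀ᶠ N : ℕ in atTop, δ * N ≤ cnt (At x y R) 0 N) :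
    y ∈ statOmega lowerDensity x := by
  intro ε hε
  obtain ⟨R, hR⟩ := exists_half_pow hε
  obtain ⟨δ, hδ, h⟩ := h R
  refine lower_pos (half_pos hδ) ?_
  filter_upwards [h, vis_ge hR hδ] with N h1 h2 using h2 0 h1

theorem mem_upper {k : ℕ} {x y : ℕ → Fin k}
    (h : ∀ R, ∃ δ > (0 : ℝ), ∃ᶠ N : ℕ in atTop, δ * N ≤ cnt (At x y R) 0 N) :
    y ∈ statOmega upperDensity x := by
  intro ε hε
  obtain ⟨R, hR⟩ := exists_half_pow hε
  obtain ⟨δ, hδ, h⟩ := h R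
  refine upper_pos (half_pos hδ) ?_
  exact (h.and_eventually (vis_ge hR hδ)).mono fun N hN => hN.2 0 hN.1

theorem mem_bupper {k : ℕ} {x y : ℕ → Fin k}
    (h : ∀ R, ∃ δ > (0 : ℝ), ∃ᶠ N : ℕ in atTop, ∃ a, δ * N ≤ cnt (At x y R) a N) :
    y ∈ statOmega banachUpperDensity x := by
  intro ε hε
  obtain ⟨R, hR⟩ := exists_half_pow hε
  obtain ⟨δ, hδ, h⟩ := h R
  refine bupper_pos (half_pos hδ) ?_
  exact (h.and_eventually (vis_ge hR hδ)).mono fun N hN => by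
    obtain ⟨⟨a, ha⟩, h2⟩ := hN
    exact ⟨a, h2 a ha⟩

theorem half_pos' (R : ℕ) : (0 : ℝ) < (1 / 2) ^ R := by positivity

theorem cast_vis_le {k : ℕ} (x y : ℕ → Fin k) (R a N : ℕ) :
    (cnt (visits x (sball y ((1 / 2) ^ R))) a N : ℝ) ≤ cnt (At x y R) a N := by
  exact_mod_cast cnt_mono (vis_sub x y R) a N

theorem not_mem_lower {k : ℕ} {x y : ℕ → Fin k} (R : ℕ)
    (h : ∀ δ > (0 : ℝ), ∃ᶠ N : ℕ in atTop, (cnt (At x y R) 0 N : ℝ) ≤ δ * N) :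
    y ∉ statOmega lowerDensity x := fun hy =>
  lower_not (fun δ hδ => (h δ hδ).mono fun N hN => (cast_vis_le x y R 0 N).trans hN)
    (hy _ (half_pos' R))

theorem not_mem_upper {k : ℕ} {x y : ℕ → Fin k} (R : ℕ)
    (h : ∀ δ > (0 : ℝ), ∀ᶠ N : ℕ in atTop, (cnt (At x y R) 0 N : ℝ) ≤ δ * N) :
    y ∉ statOmega upperDensity x := fun hy =>
  upper_not (fun δ hδ => (h δ hδ).mono fun N hN => (cast_vis_le x y R 0 N).trans hN)
    (hy _ (half_pos' R))

theorem not_mem_bupper {k : ℕ} {x y : ℕ → Fin k} (R : ℕ) (h : SmallB (At x y R)) :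
    y ∉ statOmega banachUpperDensity x := fun hy =>
  bupper_not (fun ε hε => by
    obtain ⟨C, hC, h⟩ := h ε hε
    exact ⟨C, hC, fun a N => (cast_vis_le x y R a N).trans (h a N)⟩) (hy _ (half_pos' R))

theorem not_mem_blower {k : ℕ} {x y : ℕ → Fin k} (R : ℕ)
    (h : ∃ᶠ N : ℕ in atTop, ∃ a, cnt (At x y R) a N = 0) :
    y ∉ statOmega banachLowerDensity x := fun hy =>
  blower_not (h.mono fun N ⟨a, ha⟩ => ⟨a, by
    have := cnt_mono (vis_sub x y R) a N
    omega⟩) (hy _ (half_pos' R))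

theorem bs_cyl {k : ℕ} (x y : ℕ → Fin k) (R a N : ℕ) :
    bs (cyl R y) (shift^[a] x) N = cnt (At x y R) a N := by
  classical
  unfold bs cnt
  rw [Finset.card_filter, Finset.sum_Ico_eq_sum_range]
  push_cast
  rw [Nat.add_sub_cancel_left]
  apply Finset.sum_congr rfl
  intro i _
  rw [← Function.iterate_add_apply, add_comm i a]
  unfold cyl At
  by_cases h : agr R y (shift^[a + i] x)
  · rw [if_pos h, if_pos (by exact h)]
  · rw [if_neg h, if_neg (by exact h)]

theorem bs_cyl0 {k : ℕ} (x y : ℕ → Fin k) (R N : ℕ) :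
    bs (cyl R y) x N = cnt (At x y R) 0 N := bs_cyl x y R 0 N

theorem Tf_ge (n : ℕ) : n ≤ Tf n := by
  have := Tf_eq n
  have := lt_Lf n
  omega

namespace Sys
variable {k m : ℕ} (S : Sys k m) (b : ℕ → ℕ)

/-- union of orbits selected by `P` -/
def ZU (P : Fin m → Prop) : Set (ℕ → Fin k) := {y | ∃ j, P j ∧ y ∈ S.Z j}

theorem parity_freq (t : Bool) (P : ℕ → Prop) (n0 : ℕ) (h : ∀ n ≥ n0, n.bodd = t → P (Tf n)) :
    ∃ᶠ N : ℕ in atTop, P N := by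
  rw [frequently_atTop]
  intro a
  cases t with
  | false =>
    refine ⟨Tf (2 * (n0 + a)), ?_, h _ (by omega) (by simp)⟩
    have := Tf_ge (2 * (n0 + a)); omega
  | true =>
    refine ⟨Tf (2 * (n0 + a) + 1), ?_, h _ (by omega) (by simp)⟩
    have := Tf_ge (2 * (n0 + a) + 1); omega

theorem small_of (y : ℕ → Fin k) (hy : ∀ j, y ∉ S.Z j) : ∃ R, SmallB (At (S.x b) y R) := by
  obtain ⟨R, hR⟩ := S.sep y
  refine ⟨R, fun ε hε => ?_⟩
  obtain ⟨C, hC, h⟩ := S.bad_small b R ε hε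
  refine ⟨C, hC, fun a N => le_trans ?_ (h a N)⟩
  have : At (S.x b) y R ⊆ Bad S.U R (S.x b) := fun n hn j s hj => hR j (hy j) s (agr.trans' hn hj)
  exact_mod_cast cnt_mono this a N

theorem U_avg (j : Fin m) {g : (ℕ → Fin k) → ℝ} {M : ℝ} (hg : Reg g M) :
    HasAvg g (S.U j) (bs g (S.U j) S.l / S.l) := by
  have h := Y_avg S.U S.l S.hl S.hper (fun i => if j = i then 1 else 0) (fun _ => j) ?_ g M hg
  · have e : Yseq S.U S.l (fun _ => j) = S.U j := rfl
    rw [e] at h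
    simpa using h
  · intro Q i
    have : ∑ q ∈ Finset.range Q, (2 * (q : ℝ) + 1) = (Q : ℝ) ^ 2 := by
      induction Q with
      | zero => simp
      | succ Q ih => rw [Finset.sum_range_succ, ih]; push_cast; ring
    rw [← Finset.sum_mul, this, mul_comm, sub_self, abs_zero]
    positivity

theorem omega_bupper : statOmega banachUpperDensity (S.x b) = S.ZU fun _ => True := by
  ext y
  constructor
  · intro hy
    by_contra hc
    obtain ⟨R, hR⟩ := S.small_of b y fun j hj => hc ⟨j, trivial, hj⟩
    exact not_mem_bupper R hR hy
  · rintro ⟨j, -, hj⟩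
    apply mem_bupper
    intro R
    have hl : (0 : ℝ) < S.l := by exact_mod_cast S.hl
    refine ⟨1 / S.l / 2, by positivity, ?_⟩
    obtain ⟨C, hC, h⟩ := S.U_avg j (cyl_reg R y) (1 / S.l / 8) (by positivity)
    obtain ⟨C', hC', h'⟩ := bs_transfer (cyl_reg R y) (1 / S.l / 8) (by positivity)
    obtain ⟨n1, hn1⟩ := lin_dom (C + C') (1 / S.l / 4) (by positivity)
    rw [frequently_atTop]
    intro n0
    obtain ⟨n, hn, hen⟩ := S.he j (n0 + n1)
    refine ⟨n, by omega, Lf n, ?_⟩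
    have r := S.run b n
    rw [hen] at r
    have h1 := (abs_le.1 (h n)).1
    have h2 := (abs_le.1 (h' _ _ n r)).1
    rw [bs_cyl] at h2
    have h3 := hn1 n (by omega)
    have h4 := mul_le_mul_of_nonneg_left (S.freq_ge y j hj R) (Nat.cast_nonneg (α := ℝ) n)
    linarith

theorem omega_blower (h2 : ∃ j j' : Fin m, j ≠ j') :
    statOmega banachLowerDensity (S.x b) = ∅ := by
  rw [Set.eq_empty_iff_forall_notMem]
  intro y
  obtain ⟨j, hj⟩ : ∃ j, y ∉ S.Z j := by
    obtain ⟨j, j', hne⟩ := h2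
    by_contra hc
    push Not at hc
    exact hne (S.Z_disj (hc j) (hc j'))
  obtain ⟨R, hR⟩ := S.sep1 y j hj
  apply not_mem_blower R
  rw [frequently_atTop]
  intro n0
  obtain ⟨n, hn, hen⟩ := S.he j (n0 + R)
  refine ⟨n - R, by omega, Lf n, ?_⟩
  have r := S.run b n
  rw [hen] at r
  have : cnt (At (S.x b) y R) (Lf n) (n - R) ≤ cnt ∅ 0 (n - R) := by
    apply cnt_translate
    intro i hi hA
    refine absurd ?_ (hR i)
    intro w hw
    have h1 := hA w hw
    have h2 := r (i + w) (by omega)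
    rw [shift_iter] at h1 h2 ⊢
    rw [h1, ← h2, add_assoc]
  have h0 : cnt ∅ 0 (n - R) = 0 := by rw [← cnt_eq_ncard]; simp
  omega

theorem omega_lower (hb : ∀ n, b n ≤ 1) :
    statOmega lowerDensity (S.x b) = S.ZU fun j => ∀ t, 0 < S.c t j := by
  have hl : (0 : ℝ) < S.l := by exact_mod_cast S.hl
  ext y
  constructor
  · intro hy
    by_contra hc
    by_cases hz : ∃ j, y ∈ S.Z j
    · obtain ⟨j, hj⟩ := hz
      obtain ⟨t, ht⟩ : ∃ t, S.c t j = 0 := by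
        by_contra hne
        push Not at hne
        exact hc ⟨j, fun t => lt_of_le_of_ne (S.c0 t j) (hne t).symm, hj⟩
      obtain ⟨R, hR⟩ := S.sep y
      refine not_mem_lower R (fun δ hδ => ?_) hy
      obtain ⟨n0, h⟩ := S.avgT b hb (cyl_reg R y) δ hδ
      refine parity_freq t _ n0 fun n hn hnt => ?_
      have h1 := (abs_le.1 (h n hn)).2
      rw [hnt, S.G_zero y j hj R hR t ht, bs_cyl0] at h1
      linarith
    · push Not at hz
      obtain ⟨R, hR⟩ := S.small_of b y hz
      exact not_mem_lower R (fun δ hδ => ((small_ev hR δ hδ).mono fun N h => h 0).frequently) hy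
  · rintro ⟨j, hj, hy⟩
    apply mem_lower
    intro R
    set c := min (S.c true j) (S.c false j) with hc
    have hcp : 0 < c := lt_min (hj _) (hj _)
    refine ⟨c / S.l / 2, by positivity, ?_⟩
    obtain ⟨N0, h⟩ := S.avgL b hb (cyl_reg R y) (c / S.l) (fun t => by
      refine le_trans ?_ (S.G_ge y j hy R t)
      apply div_le_div_of_nonneg_right _ hl.le
      cases t
      · exact min_le_right _ _
      · exact min_le_left _ _) (c / S.l / 2) (by positivity)
    filter_upwards [eventually_ge_atTop N0] with N hN
    have := h N hN
    rw [bs_cyl0] at this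
    linarith

theorem omega_upper (hb : ∀ n, b n ≤ 1) :
    statOmega upperDensity (S.x b) = S.ZU fun j => ∃ t, 0 < S.c t j := by
  have hl : (0 : ℝ) < S.l := by exact_mod_cast S.hl
  ext y
  constructor
  · intro hy
    by_contra hc
    by_cases hz : ∃ j, y ∈ S.Z j
    · obtain ⟨j, hj⟩ := hz
      have ht : ∀ t, S.c t j = 0 := by
        intro t
        by_contra hne
        exact hc ⟨j, ⟨t, lt_of_le_of_ne (S.c0 t j) (Ne.symm hne)⟩, hj⟩
      obtain ⟨R, hR⟩ := S.sep y
      refine not_mem_upper R (fun δ hδ => ?_) hy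
      obtain ⟨N0, h⟩ := S.avgU b hb (cyl_reg R y) 0
        (fun t => (S.G_zero y j hj R hR t (ht t)).le) δ hδ
      filter_upwards [eventually_ge_atTop N0] with N hN
      have := h N hN
      rw [bs_cyl0] at this
      linarith
    · push Not at hz
      obtain ⟨R, hR⟩ := S.small_of b y hz
      exact not_mem_upper R (fun δ hδ => ((small_ev hR δ hδ).mono fun N h => h 0)) hy
  · rintro ⟨j, ⟨t, ht⟩, hy⟩
    apply mem_upper
    intro R
    refine ⟨S.c t j / S.l / 2, by positivity, ?_⟩
    obtain ⟨n0, h⟩ := S.avgT b hb (cyl_reg R y) (S.c t j / S.l / 2) (by positivity)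
    refine parity_freq t _ n0 fun n hn hnt => ?_
    have h1 := (abs_le.1 (h n hn)).1
    rw [hnt, bs_cyl0] at h1
    have := mul_le_mul_of_nonneg_left (S.G_ge y j hy R t) (Nat.cast_nonneg (α := ℝ) (Tf n))
    linarith

theorem x_not_Z (h2 : ∃ j j' : Fin m, j ≠ j') (j : Fin m) : S.x b ∉ S.Z j := by
  rintro ⟨s, hs⟩
  obtain ⟨j', hne⟩ : ∃ j', j' ≠ j := by
    obtain ⟨i, i', hi⟩ := h2
    by_cases h : i = j
    · exact ⟨i', fun h' => hi (h.trans h'.symm)⟩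
    · exact ⟨i, h⟩
  obtain ⟨n, hn, hen⟩ := S.he j' S.l
  have r := S.run b n
  rw [hen, ← hs] at r
  simp only at r
  rw [← Function.iterate_add_apply] at r
  refine S.hdisj j j' hne.symm (Lf n + s) 0 ?_
  have hmod : ∀ (i : Fin m) p, S.U i p = S.U i (p % S.l) := by
    intro i p
    have := congrFun (S.iter_mod i p) 0
    rwa [shift_iter, shift_iter] at this
  funext i
  have h1 := r (i % S.l) (lt_of_lt_of_le (Nat.mod_lt _ S.hl) hn)
  rw [shift_iter] at h1 ⊢
  show _ = S.U j' i
  rw [hmod j' i, ← h1, hmod j, hmod j (Lf n + s + i % S.l)]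
  congr 1
  simp [Nat.add_mod]

theorem omega_strict (h2 : ∃ j j' : Fin m, j ≠ j') :
    statOmega banachUpperDensity (S.x b) ⊂ omegaLim (S.x b) := by
  rw [omega_bupper]
  refine (Set.ssubset_iff_of_subset ?_).2 ⟨S.x b, ?_, ?_⟩
  · rintro _ ⟨j, -, s, rfl⟩ ε hε N
    obtain ⟨R, hR⟩ := exists_half_pow hε
    obtain ⟨n, hn, hen⟩ := S.he j (N + s + R)
    have := lt_Lf n
    refine ⟨Lf n + s, by omega, lt_of_le_of_lt (sd_le (R := R) ?_) hR⟩
    have r := S.run b n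
    rw [hen] at r
    intro i hi
    have h1 := r (s + i) (by omega)
    simp only
    rw [shift_iter] at h1 ⊢
    rw [shift_iter, ← h1, add_assoc]
  · intro ε hε N
    obtain ⟨R, hR⟩ := exists_half_pow hε
    refine ⟨Tf (N + R), by have := Tf_ge (N + R); omega, lt_of_le_of_lt (sd_le (R := R) ?_) hR⟩
    intro i hi
    rw [shift_iter]
    exact (X_copy (S.V b) _ _ (by have := lt_Lf (N + R); omega)).symm
  · rintro ⟨j, -, hj⟩
    exact S.x_not_Z b h2 j hj

theorem x_rec : Recurrent (S.x b) := X_recurrent _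

theorem x_not_br (h2 : ∃ j j' : Fin m, j ≠ j') : ¬ BanachRecurrent (S.x b) := by
  intro h
  have : S.x b ∈ statOmega banachUpperDensity (S.x b) := h
  rw [omega_bupper] at this
  obtain ⟨j, -, hj⟩ := this
  exact S.x_not_Z b h2 j hj

theorem birk_eq (g : (ℕ → Fin k) → ℝ) (z : ℕ → Fin k) (N : ℕ) : birkhoffAvg g z N = bs g z N / N := rfl

theorem x_tendsto (hb : ∀ n, b n ≤ 1) {g : (ℕ → Fin k) → ℝ} {M : ℝ} (hg : Reg g M) (a : ℝ)
    (h : ∀ t, S.G g t = a) : Tendsto (birkhoffAvg g (S.x b)) atTop (𝓝 a) := by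
  rw [Metric.tendsto_atTop]
  intro ε hε
  obtain ⟨N0, h0⟩ := S.avgL b hb hg a (fun t => (h t).ge) (ε / 2) (by positivity)
  obtain ⟨N1, h1⟩ := S.avgU b hb hg a (fun t => (h t).le) (ε / 2) (by positivity)
  refine ⟨N0 + N1 + 1, fun N hN => ?_⟩
  have hN' : (0 : ℝ) < N := by exact_mod_cast (by omega)
  have q0 := h0 N (by omega)
  have q1 := h1 N (by omega)
  rw [← le_div_iff₀ hN'] at q0
  rw [← div_le_iff₀ hN'] at q1
  rw [Real.dist_eq, birk_eq, abs_lt]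
  constructor <;> linarith

theorem Tf_tendsto_avg (hb : ∀ n, b n ≤ 1) {g : (ℕ → Fin k) → ℝ} {M : ℝ} (hg : Reg g M) (c : ℝ)
    (h : Tendsto (birkhoffAvg g (S.x b)) atTop (𝓝 c)) (t : Bool) : S.G g t = c := by
  by_contra hne
  have hd : 0 < |S.G g t - c| := abs_pos.2 (sub_ne_zero.2 hne)
  obtain ⟨n0, h0⟩ := S.avgT b hb hg (|S.G g t - c| / 3) (by positivity)
  have h1 := (Metric.tendsto_nhds.1 h) (|S.G g t - c| / 3) (by positivity)
  have h2 : ∃ᶠ N : ℕ in atTop, |birkhoffAvg g (S.x b) N - S.G g t| ≤ |S.G g t - c| / 3 := by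
    refine parity_freq t _ n0 fun n hn hnt => ?_
    have h3 := h0 n hn
    have hT : (0 : ℝ) < Tf n := by
      have := Tf_eq n
      have := Lf_pos n
      exact_mod_cast (by omega)
    rw [hnt] at h3
    rw [birk_eq]
    have e : bs g (S.x b) (Tf n) / Tf n - S.G g t = (bs g (S.x b) (Tf n) - Tf n * S.G g t) / Tf n := by
      field_simp
    rw [e, abs_div, Nat.abs_cast, div_le_iff₀ hT]
    exact h3
  obtain ⟨N, hN, hN'⟩ := (h2.and_eventually h1).exists
  rw [Real.dist_eq] at hN'
  have := abs_sub_le (S.G g t) (birkhoffAvg g (S.x b) N) c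
  rw [abs_sub_comm (S.G g t) (birkhoffAvg g (S.x b) N)] at this
  linarith

theorem x_irreg (hb : ∀ n, b n ≤ 1) {g : (ℕ → Fin k) → ℝ} {M : ℝ} (hg : Reg g M)
    (h : S.G g true ≠ S.G g false) : IrregularPt g (S.x b) := by
  rintro ⟨c, hc⟩
  exact h ((S.Tf_tendsto_avg b hb hg c hc true).trans (S.Tf_tendsto_avg b hb hg c hc false).symm)

theorem flag (P Q : Fin m → Prop) (hPQ : ∀ j, P j → Q j) (f : Bool)
    (hf : f = true ↔ ∃ j, Q j ∧ ¬ P j) : strictOrEq f (S.ZU P) (S.ZU Q) := by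
  have hsub : S.ZU P ⊆ S.ZU Q := fun y ⟨j, h, hy⟩ => ⟨j, hPQ j h, hy⟩
  unfold strictOrEq
  by_cases h : f = true
  · rw [if_pos h]
    obtain ⟨j, hj, hj'⟩ := hf.1 h
    refine (Set.ssubset_iff_of_subset hsub).2 ⟨S.U j, ⟨j, hj, 0, rfl⟩, ?_⟩
    rintro ⟨i, hi, hy⟩
    exact hj' (S.Z_disj hy ⟨0, rfl⟩ ▸ hi)
  · rw [if_neg h]
    refine hsub.antisymm ?_
    rintro y ⟨j, h1, hy⟩
    refine ⟨j, ?_, hy⟩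
    by_contra hc
    exact h (hf.2 ⟨j, h1, hc⟩)

theorem x_case (hb : ∀ n, b n ≤ 1) (h2 : ∃ j j' : Fin m, j ≠ j') (i : Fin 6)
    (f1 : (caseFlags i).1 = true ↔ ∃ j, ∀ t, 0 < S.c t j)
    (f2 : (caseFlags i).2.1 = true ↔ ∃ j, (∃ t, 0 < S.c t j) ∧ ¬ ∀ t, 0 < S.c t j)
    (f3 : (caseFlags i).2.2 = true ↔ ∃ j, ¬ ∃ t, 0 < S.c t j) : SatCase' i (S.x b) := by
  refine ⟨?_, ?_, ?_, S.omega_strict b h2⟩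
  · rw [S.omega_blower b h2, S.omega_lower b hb]
    have := S.flag (fun _ => False) (fun j => ∀ t, 0 < S.c t j) (fun _ h => h.elim)
      (caseFlags i).1 (by simpa using f1)
    have e : S.ZU (fun _ => False) = ∅ := by
      rw [Set.eq_empty_iff_forall_notMem]
      rintro y ⟨j, h, -⟩
      exact h
    rwa [e] at this
  · rw [S.omega_upper b hb, S.omega_lower b hb]
    exact S.flag _ _ (fun j h => ⟨true, h true⟩) _ f2
  · rw [S.omega_upper b hb, S.omega_bupper b]
    exact S.flag _ _ (fun _ _ => trivial) _ (by simpa using f3)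

end Sys

theorem cnt_full {S : Set ℕ} {a N : ℕ} (h : ∀ i < N, a + i ∈ S) : N ≤ cnt S a N := by
  have h1 : cnt Set.univ a N ≤ cnt S a N := cnt_translate fun i hi _ => h i hi
  have h2 : cnt Set.univ a N = N := by
    rw [← cnt_eq_ncard, Set.univ_inter, Set.ncard_eq_toFinset_card']
    simp
  omega

/-- closeness times -/
def Cl {k : ℕ} (x y : ℕ → Fin k) (t : ℝ) : Set ℕ := {i | shiftDist (shift^[i] x) (shift^[i] y) < t}

theorem PhiN_eq {k : ℕ} (x y : ℕ → Fin k) (n : ℕ) (t : ℝ) :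
    PhiN x y n t = (cnt (Cl x y t) 0 n : ℝ) / n := by
  unfold PhiN
  rw [← Iio_cnt]
  congr 3
  ext i
  simp [Cl, and_comm]

theorem not_dc1_self {k : ℕ} (x : ℕ → Fin k) : ¬ DC1Pair x x := by
  rintro ⟨⟨s, hs, h⟩, -⟩
  simp only [PhiN_eq] at h
  have : (1 : ℝ) ≤ liminf (fun n => (cnt (Cl x x s) 0 n : ℝ) / n) atTop := by
    refine li_ge (fun n => ratio_le _ 0 n) ?_
    filter_upwards [eventually_ge_atTop 1] with N hN
    refine ratio_ge hN ?_
    rw [one_mul]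
    exact_mod_cast cnt_full fun i _ => by
      show shiftDist _ _ < s
      simpa [shiftDist] using hs
  linarith

def bit (c : ℕ → Bool) (n : ℕ) : ℕ :=
  if (Nat.unpair n).1 = 0 then 0 else if c ((Nat.unpair n).1 - 1) then 1 else 0

theorem bit_le (c : ℕ → Bool) (n : ℕ) : bit c n ≤ 1 := by
  unfold bit; split_ifs <;> simp

theorem bit_eq (c c' : ℕ → Bool) (n0 : ℕ) : ∃ n ≥ n0, bit c n = bit c' n := by
  refine ⟨Nat.pair 0 n0, Nat.right_le_pair 0 n0, ?_⟩
  simp [bit]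

theorem bit_ne (c c' : ℕ → Bool) (h : c ≠ c') (n0 : ℕ) : ∃ n ≥ n0, bit c n ≠ bit c' n := by
  obtain ⟨p, hp⟩ := Function.ne_iff.1 h
  refine ⟨Nat.pair (p + 1) n0, Nat.right_le_pair _ n0, ?_⟩
  simp [bit]
  cases h1 : c p <;> cases h2 : c' p <;> simp_all

namespace Sys
variable {k m : ℕ} (S : Sys k m)

theorem dc1_same (b b' : ℕ → ℕ) (h : ∀ n0, ∃ n ≥ n0, b n = b' n) (t : ℝ) (ht : 0 < t) :
    limsup (fun n => PhiN (S.x b) (S.x b') n t) atTop = 1 := by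
  simp only [PhiN_eq]
  obtain ⟨R, hR⟩ := exists_half_pow ht
  apply le_antisymm
  · exact ls_le (fun n => ratio_nonneg _ 0 n) (Eventually.of_forall fun n => ratio_le _ 0 n)
  · refine le_of_forall_pos_le_add fun δ hδ => ?_
    suffices 1 - δ ≤ limsup (fun n => (cnt (Cl (S.x b) (S.x b') t) 0 n : ℝ) / n) atTop by linarith
    refine ls_ge (fun n => ratio_le _ 0 n) ?_
    rw [frequently_atTop]
    intro n0
    obtain ⟨n1, hn1⟩ := lin_dom (1 + R) δ hδ
    obtain ⟨n, hn, hbn⟩ := h (n0 + n1)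
    have e1 := Tf_eq n
    have hL := Lf_pos n
    refine ⟨Tf n, by have := Tf_ge n; omega, ratio_ge (by omega) ?_⟩
    have hV : S.V b n = S.V b' n := by
      funext p
      simp only [V, Vs, hbn]
    have c1 : Df n - R ≤ cnt (Cl (S.x b) (S.x b') t) (Lf n) (Df n - R) := by
      apply cnt_full
      intro i hi
      refine lt_of_le_of_lt (sd_le (R := R) ?_) hR
      intro w hw
      rw [shift_iter, shift_iter]
      unfold x
      rw [add_assoc, X_fill _ _ _ (by omega), X_fill _ _ _ (by omega), hV]
    have c2 : cnt (Cl (S.x b) (S.x b') t) (Lf n) (Df n - R) ≤ cnt (Cl (S.x b) (S.x b') t) 0 (Tf n) := by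
      rw [show Tf n = Lf n + ((Df n - R) + (Df n - (Df n - R))) by omega, cnt_split, cnt_split,
        zero_add]
      omega
    have c3 : (Df n : ℝ) ≤ cnt (Cl (S.x b) (S.x b') t) 0 (Tf n) + R := by
      exact_mod_cast (by omega)
    have c4 := hn1 n (by omega)
    have c5 : (1 : ℝ) ≤ Lf n := by exact_mod_cast hL
    have c6 : (Tf n : ℝ) = (n + 2) * Lf n := by simp [Tf]
    have c7 : (Df n : ℝ) = (n + 1) * Lf n := by simp [Df]
    have c8 : (1 + R) * (Lf n : ℝ) ≤ δ * n * Lf n := mul_le_mul_of_nonneg_right c4 (by positivity)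
    have c9 : (R : ℝ) ≤ R * Lf n := le_mul_of_one_le_right (by positivity) c5
    have c10 : 0 ≤ δ * Lf n := by positivity
    rw [c6]
    rw [c7] at c3
    nlinarith

theorem U_mod (i : Fin m) (p : ℕ) : S.U i p = S.U i (p % S.l) := by
  have := congrFun (S.iter_mod i p) 0
  rwa [shift_iter, shift_iter] at this

theorem Y_noshift (n p : ℕ) (hp : p ∉ SqSet S.l (2 * S.l + 1)) :
    ¬ agr (2 * S.l) (shift^[p] (S.Y n)) (shift^[p + 1] (S.Y n)) := by
  intro h
  have h1 := Y_agr S.U S.l S.hl (S.K n.bodd) (2 * S.l + 1) p hp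
  set j := S.K n.bodd (Nat.sqrt (p / S.l))
  obtain ⟨i0, hi0, hne⟩ := S.hnc j
  have hpl := Nat.mod_lt p S.hl
  set i := i0 + (S.l - p % S.l) with hi
  have hilt : i < 2 * S.l := by omega
  have h2 := h i hilt
  have h3 := h1 i (by omega)
  have h4 := h1 (i + 1) (by omega)
  rw [shift_iter, shift_iter] at h2 h3 h4
  have h5 : S.U j (p + i) = S.U j (p + (i + 1)) := by
    rw [← h3, ← h4]
    rw [show p + (i + 1) = p + 1 + i by omega]
    exact h2
  have hdm := Nat.div_add_mod p S.l
  have e1 : p + i = i0 + S.l * (p / S.l + 1) := by rw [mul_add]; omega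
  have e2 : p + (i + 1) = (i0 + 1) + S.l * (p / S.l + 1) := by rw [mul_add]; omega
  rw [e1, e2, S.U_mod, S.U_mod j (i0 + 1 + _), Nat.add_mul_mod_self_left,
    Nat.add_mul_mod_self_left, ← S.U_mod, ← S.U_mod] at h5
  exact hne h5

theorem dc1_diff (b b' : ℕ → ℕ) (hb : ∀ n, b n ≤ 1) (hb' : ∀ n, b' n ≤ 1)
    (h : ∀ n0, ∃ n ≥ n0, b n ≠ b' n) :
    liminf (fun n => PhiN (S.x b) (S.x b') n ((1 / 2) ^ (2 * S.l))) atTop = 0 := by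
  simp only [PhiN_eq]
  set E := Cl (S.x b) (S.x b') ((1 / 2) ^ (2 * S.l)) with hE
  apply le_antisymm
  swap
  · exact li_ge (fun n => ratio_le _ 0 n) (Eventually.of_forall fun n => ratio_nonneg _ 0 n)
  refine le_of_forall_pos_le_add fun δ hδ => ?_
  rw [zero_add]
  refine li_le (fun n => ratio_nonneg _ 0 n) ?_
  rw [frequently_atTop]
  intro n0
  obtain ⟨C, hC, hsq⟩ := sq_small S.l (2 * S.l + 1) S.hl (δ / 2) (by positivity)
  obtain ⟨n1, hn1⟩ := lin_dom (2 + C + 2 * S.l) (δ / 2) (by positivity)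
  obtain ⟨n, hn, hbn⟩ := h (n0 + n1)
  have e1 := Tf_eq n
  have hL := Lf_pos n
  have hnL := lt_Lf n
  refine ⟨Tf n, by have := Tf_ge n; omega, ratio_le' hδ.le ?_⟩
  have c1 : cnt E (Lf n + n) (Df n - n - 2 * S.l) ≤
      cnt (SqSet S.l (2 * S.l + 1)) 0 (Df n - n - 2 * S.l) := by
    apply cnt_translate
    intro p hp hpE
    rw [zero_add]
    by_contra hns
    have ha : agr (2 * S.l) (shift^[Lf n + n + p] (S.x b)) (shift^[Lf n + n + p] (S.x b')) :=
      agr_of_sd hpE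
    have hx : ∀ b : ℕ → ℕ, agr (2 * S.l) (shift^[Lf n + n + p] (S.x b)) (shift^[p + b n] (S.Y n)) := by
      intro b w hw
      rw [shift_iter, shift_iter]
      unfold x
      rw [show Lf n + n + p + w = Lf n + (n + p + w) by omega, X_fill _ _ _ (by omega)]
      unfold V Vs
      rw [if_neg (by omega)]
      congr 1; omega
    have hY := ((hx b).symm'.trans' ha).trans' (hx b')
    have hb1 := hb n
    have hb1' := hb' n
    have hcase : (b n = 0 ∧ b' n = 1) ∨ (b n = 1 ∧ b' n = 0) := by omega
    rcases hcase with ⟨q, q'⟩ | ⟨q, q'⟩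
    · rw [q, q'] at hY
      exact S.Y_noshift n p hns hY
    · rw [q, q'] at hY
      exact S.Y_noshift n p hns hY.symm'
  have c2 : cnt E 0 (Tf n) ≤ Lf n + n + cnt E (Lf n + n) (Df n - n - 2 * S.l) + 2 * S.l := by
    have hDn : n ≤ Df n := by have := Lf_le_Df n; omega
    rw [show Tf n = (Lf n + n) + ((Df n - n - 2 * S.l) + (Df n - n - (Df n - n - 2 * S.l))) by omega,
      cnt_split E 0 (Lf n + n), zero_add, cnt_split E (Lf n + n)]
    have q1 := cnt_le E 0 (Lf n + n)
    have q2 := cnt_le E (Lf n + n + (Df n - n - 2 * S.l)) (Df n - n - (Df n - n - 2 * S.l))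
    omega
  have c3 := hsq 0 (Df n - n - 2 * S.l)
  have c4 : ((Df n - n - 2 * S.l : ℕ) : ℝ) ≤ Tf n := by exact_mod_cast (by omega)
  have c5 : (cnt E 0 (Tf n) : ℝ) ≤
      Lf n + n + cnt (SqSet S.l (2 * S.l + 1)) 0 (Df n - n - 2 * S.l) + 2 * S.l := by
    exact_mod_cast c2.trans (by omega)
  have c6 := hn1 n (by omega)
  have c7 : (1 : ℝ) ≤ Lf n := by exact_mod_cast hL
  have c8 : (n : ℝ) ≤ Lf n := by exact_mod_cast hnL.le
  have c9 : (Tf n : ℝ) = (n + 2) * Lf n := by simp [Tf]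
  have c10 : (2 + C + 2 * S.l) * (Lf n : ℝ) ≤ δ / 2 * n * Lf n :=
    mul_le_mul_of_nonneg_right c6 (by positivity)
  have c11 : C + 2 * S.l ≤ (C + 2 * S.l) * Lf n := le_mul_of_one_le_right (by positivity) c7
  have c12 := mul_le_mul_of_nonneg_left c4 (show 0 ≤ δ / 2 by positivity)
  have c13 : δ / 2 * n * Lf n ≤ δ / 2 * Tf n := by
    rw [c9, mul_assoc]
    apply mul_le_mul_of_nonneg_left _ (by positivity)
    nlinarith
  linarith

theorem dc1 (c c' : ℕ → Bool) (h : c ≠ c') : DC1Pair (S.x (bit c)) (S.x (bit c')) :=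
  ⟨⟨_, half_pos' (2 * S.l), S.dc1_diff _ _ (bit_le c) (bit_le c') (bit_ne c c' h)⟩,
    fun t ht => S.dc1_same _ _ (bit_eq c c') t ht⟩

theorem x_inj : Function.Injective fun c => S.x (bit c) := by
  intro c c' h
  by_contra hne
  have := S.dc1 c c' hne
  simp only at h
  rw [h] at this
  exact not_dc1_self _ this

def scr : Set (ℕ → Fin k) := Set.range fun c => S.x (bit c)

theorem scr_dc1 : DC1Scrambled S.scr := by
  constructor
  · refine ⟨_, ⟨fun _ => true, rfl⟩, _, ⟨fun _ => false, rfl⟩, fun h => ?_⟩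
    have := congrFun (S.x_inj h) 0
    simp at this
  · rintro _ ⟨c, rfl⟩ _ ⟨c', rfl⟩ hne
    exact S.dc1 c c' fun h => hne (by rw [h])

theorem scr_unc : ¬ S.scr.Countable := by
  intro h
  have h1 : (Set.univ : Set (ℕ → Bool)).Countable := by
    apply Set.countable_of_injective_of_countable_image (f := fun c => S.x (bit c)) S.x_inj.injOn
    rw [Set.image_univ]
    exact h
  have h2 : Countable (ℕ → Bool) := Set.countable_univ_iff.1 h1
  obtain ⟨f, hf⟩ := exists_injective_nat (ℕ → Bool)
  classical
  refine Function.cantor_injective (fun s : Set ℕ => f fun n => decide (n ∈ s)) ?_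
  intro s s' hs
  have := hf hs
  ext n
  have := congrFun this n
  simpa using this

end Sys

theorem shift_meas {k : ℕ} : Measurable (shift : (ℕ → Fin k) → (ℕ → Fin k)) :=
  measurable_pi_lambda _ fun n => measurable_pi_apply (n + 1)

theorem exists_low {k : ℕ} (φ : (ℕ → Fin k) → ℝ) (hφ : Continuous φ) {M : ℝ} (hg : Reg φ M)
    (μ : Measure (ℕ → Fin k)) (hμ : IsProbabilityMeasure μ) (hinv : μ.map shift = μ) (n : ℕ) :
    ∃ x, bs φ x n ≤ n * ∫ z, φ z ∂μ := by
  have hmeas : Measurable φ := hφ.measurable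
  have hit : ∀ i, Measurable (shift^[i] : (ℕ → Fin k) → (ℕ → Fin k)) := fun i => shift_meas.iterate i
  have hmp : MeasurePreserving (shift : (ℕ → Fin k) → (ℕ → Fin k)) μ μ := ⟨shift_meas, hinv⟩
  have hint : ∀ i, Integrable (fun z => φ (shift^[i] z)) μ := fun i =>
    Integrable.of_bound ((hmeas.comp (hit i)).aestronglyMeasurable) M
      (Eventually.of_forall fun z => hg.1 _)
  have hval : ∀ i, ∫ z, φ (shift^[i] z) ∂μ = ∫ z, φ z ∂μ := by
    intro i
    have h1 := (hmp.iterate i).map_eq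
    conv_rhs => rw [← h1]
    rw [integral_map (hit i).aemeasurable hmeas.aestronglyMeasurable]
  have hsum : ∫ z, bs φ z n ∂μ = n * ∫ z, φ z ∂μ := by
    unfold bs
    rw [integral_finsetSum _ fun i _ => hint i]
    simp [hval]
  obtain ⟨x, hx⟩ := exists_le_integral (μ := μ) (f := fun z => bs φ z n)
    (integrable_finsetSum _ fun i _ => hint i)
  exact ⟨x, hx.trans hsum.le⟩

theorem low_words {k : ℕ} (φ : (ℕ → Fin k) → ℝ) (hφ : Continuous φ) {M : ℝ} (hg : Reg φ M)
    (μ : Measure (ℕ → Fin k)) (hμ : IsProbabilityMeasure μ) (hinv : μ.map shift = μ)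
    (a : ℝ) (ha : ∫ z, φ z ∂μ < a) :
    ∃ n0, ∀ n ≥ n0, ∃ x : ℕ → Fin k, ∀ u, agr n u x → bs φ u (n + 6) < a * (n + 6) := by
  set α := ∫ z, φ z ∂μ with hα
  obtain ⟨C, hC, h⟩ := bs_transfer hg ((a - α) / 2) (by linarith)
  obtain ⟨n0, hn0⟩ := lin_dom (C + 6 * M + 6 * |a| + 1) ((a - α) / 2) (by linarith)
  refine ⟨n0, fun n hn => ?_⟩
  obtain ⟨x, hx⟩ := exists_low φ hφ hg μ hμ hinv n
  refine ⟨x, fun u hu => ?_⟩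
  have h1 := (abs_le.1 (h u x n hu)).2
  have h2 := (abs_le.1 (bs_abs_le hg (shift^[n] u) 6)).2
  have h3 := hn0 n hn
  have h4 := neg_abs_le a
  rw [bs_add]
  rw [← hα] at hx
  push_cast at *
  linarith

/-- the periodic point with given word -/
def per {k : ℕ} (s0 s1 : Fin k) (n e : ℕ) (x : ℕ → Fin k) (p : ℕ) : Fin k :=
  if p % (n + 6) < n then x (p % (n + 6)) else if p % (n + 6) < n + e then s0 else s1

theorem per_agr {k : ℕ} (s0 s1 : Fin k) (n e : ℕ) (x : ℕ → Fin k) : agr n (per s0 s1 n e x) x := by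
  intro i hi
  rw [per, Nat.mod_eq_of_lt (by omega), if_pos hi]

theorem per_count {k : ℕ} (s0 s1 : Fin k) (hs : s1 ≠ s0) (n e : ℕ) (he1 : 1 ≤ e) (he : e ≤ 5)
    (x : ℕ → Fin k) : Nat.count (fun p => per s0 s1 n e x p = s0) (n + 6) =
      Nat.count (fun p => x p = s0) n + e := by
  rw [Nat.count_add]
  have h1 : Nat.count (fun p => per s0 s1 n e x p = s0) n = Nat.count (fun p => x p = s0) n := by
    rw [Nat.count_eq_card_filter_range, Nat.count_eq_card_filter_range]
    congr 1
    apply Finset.filter_congr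
    intro i hi
    rw [per_agr s0 s1 n e x i (Finset.mem_range.1 hi)]
  have h2 : Nat.count (fun p => per s0 s1 n e x (n + p) = s0) 6 = e := by
    have h3 : ∀ p < 6, (per s0 s1 n e x (n + p) = s0 ↔ p < e) := by
      intro p hp
      rw [per, Nat.mod_eq_of_lt (by omega), if_neg (by omega)]
      by_cases h : p < e
      · rw [if_pos (by omega)]; simp [h]
      · rw [if_neg (by omega)]; simp [h, hs]
    rw [Nat.count_eq_card_filter_range]
    rw [Finset.filter_congr fun p hp => h3 p (Finset.mem_range.1 hp)]
    interval_cases e <;> decide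
  rw [h1, h2]

theorem count_inv {k : ℕ} (s0 : Fin k) (l : ℕ) (u v : ℕ → Fin k) (hu : ∀ i, u (i + l) = u i)
    (hv : ∀ i, v (i + l) = v i) (s s' : ℕ) (h : shift^[s] u = shift^[s'] v) :
    Nat.count (fun p => u p = s0) l = Nat.count (fun p => v p = s0) l := by
  have key : ∀ (u : ℕ → Fin k) (hu : ∀ i, u (i + l) = u i) (s : ℕ),
      Nat.count (fun p => u p = s0) l = Nat.count (fun p => shift^[s] u p = s0) l := by
    intro u hu s
    rw [← Nat.filter_Ico_card_eq_of_periodic s l (fun p => u p = s0) (fun p => by simp [hu])]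
    rw [Nat.count_eq_card_filter_range]
    symm
    apply Finset.card_bij (fun i _ => s + i)
    · intro i hi
      simp only [Finset.mem_filter, Finset.mem_range, Finset.mem_Ico, shift_iter] at hi ⊢
      exact ⟨⟨by omega, by omega⟩, hi.2⟩
    · intro i _ j _ h
      omega
    · intro i hi
      simp only [Finset.mem_filter, Finset.mem_Ico] at hi
      refine ⟨i - s, ?_, by omega⟩
      simp only [Finset.mem_filter, Finset.mem_range, shift_iter]
      refine ⟨by omega, ?_⟩
      rw [show s + (i - s) = i by omega]
      exact hi.2
  rw [key u hu s, key v hv s', h]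

theorem exists_orbits (k : ℕ) (hk : 2 ≤ k) (φ : (ℕ → Fin k) → ℝ) (hφ : Continuous φ) {M : ℝ}
    (hg : Reg φ M) (a : ℝ) (ha : sInf (LphiVals k φ) < a ∧ a < sSup (LphiVals k φ)) :
    ∃ (l : ℕ) (U : Fin 5 → ℕ → Fin k), 0 < l ∧ (∀ j i, U j (i + l) = U j i) ∧
      (∀ j j', j ≠ j' → ∀ s s', shift^[s] (U j) ≠ shift^[s'] (U j')) ∧
      (∀ j, ∃ i, i + 1 < l ∧ U j i ≠ U j (i + 1)) ∧
      (∀ j : Fin 5, j.val % 2 = 0 → bs φ (U j) l / l < a) ∧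
      (∀ j : Fin 5, j.val % 2 = 1 → a < bs φ (U j) l / l) := by
  have hne : (LphiVals k φ).Nonempty := by
    by_contra h
    rw [Set.not_nonempty_iff_eq_empty] at h
    rw [h] at ha
    simp at ha
    linarith
  obtain ⟨_, ⟨μ, hμ, hinv, rfl⟩, h1⟩ := exists_lt_of_csInf_lt hne ha.1
  obtain ⟨_, ⟨ν, hν, hinv', rfl⟩, h2⟩ := exists_lt_of_lt_csSup hne ha.2
  obtain ⟨n1, hn1⟩ := low_words φ hφ hg μ hμ hinv a h1
  obtain ⟨n2, hn2⟩ := low_words (fun z => - φ z) hφ.neg hg.neg ν hν hinv' (-a)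
    (by rw [integral_neg]; linarith)
  set n := n1 + n2
  obtain ⟨xl, hxl⟩ := hn1 n (by omega)
  obtain ⟨xu, hxu⟩ := hn2 n (by omega)
  set s0 : Fin k := ⟨0, by omega⟩
  set s1 : Fin k := ⟨1, by omega⟩
  have hs : s1 ≠ s0 := by simp [s0, s1]
  let x : Fin 5 → ℕ → Fin k := fun j => if j.val % 2 = 0 then xl else xu
  let e : Fin 5 → ℕ := fun j => 1 + (j.val + 4 * Nat.count (fun p => x j p = s0) n + 4) % 5
  have he1 : ∀ j, 1 ≤ e j := fun j => by simp only [e]; omega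
  have he5 : ∀ j, e j ≤ 5 := fun j => by simp only [e]; omega
  have hper : ∀ j i, per s0 s1 n (e j) (x j) (i + (n + 6)) = per s0 s1 n (e j) (x j) i := by
    intro j i
    simp [per]
  have hl : (0 : ℝ) < ((n + 6 : ℕ) : ℝ) := by positivity
  refine ⟨n + 6, fun j => per s0 s1 n (e j) (x j), by omega, hper, ?_, ?_, ?_, ?_⟩
  · intro j j' hjj s s' h
    have h3 := count_inv s0 (n + 6) _ _ (hper j) (hper j') s s' h
    rw [per_count s0 s1 hs n _ (he1 j) (he5 j), per_count s0 s1 hs n _ (he1 j') (he5 j')] at h3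
    apply hjj
    simp only [e] at h3
    have := j.2
    have := j'.2
    ext
    omega
  · intro j
    have q1 := he1 j
    have q5 := he5 j
    refine ⟨n + e j - 1, by omega, ?_⟩
    have A : per s0 s1 n (e j) (x j) (n + e j - 1) = s0 := by
      rw [per, Nat.mod_eq_of_lt (by omega), if_neg (by omega), if_pos (by omega)]
    have B : per s0 s1 n (e j) (x j) (n + e j) = s1 := by
      rw [per, Nat.mod_eq_of_lt (by omega), if_neg (by omega), if_neg (by omega)]
    show per s0 s1 n (e j) (x j) (n + e j - 1) ≠ per s0 s1 n (e j) (x j) (n + e j - 1 + 1)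
    rw [show n + e j - 1 + 1 = n + e j by omega, A, B]
    exact hs.symm
  · intro j hj
    rw [div_lt_iff₀ hl]
    have := hxl (per s0 s1 n (e j) (x j)) (by
      have := per_agr s0 s1 n (e j) (x j)
      simp only [x, if_pos hj] at this ⊢
      exact this)
    push_cast at *
    exact this
  · intro j hj
    rw [lt_div_iff₀ hl]
    have := hxu (per s0 s1 n (e j) (x j)) (by
      have := per_agr s0 s1 n (e j) (x j)
      simp only [x, if_neg (show ¬ j.val % 2 = 0 by omega)] at this ⊢
      exact this)
    rw [bs_neg] at this
    push_cast at *
    linarith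

theorem mk_sys {k m : ℕ} (hm : 0 < m) (hm5 : m ≤ 5) (l : ℕ) (U : Fin 5 → ℕ → Fin k) (hl : 0 < l)
    (hper : ∀ j i, U j (i + l) = U j i)
    (hdisj : ∀ j j', j ≠ j' → ∀ s s', shift^[s] (U j) ≠ shift^[s'] (U j'))
    (hnc : ∀ j, ∃ i, i + 1 < l ∧ U j i ≠ U j (i + 1)) (c : Bool → Fin m → ℝ)
    (c0 : ∀ t j, 0 ≤ c t j) (c1 : ∀ t, ∑ j, c t j = 1) :
    ∃ S : Sys k m, S.c = c ∧ ∀ g t, S.G g t = ∑ j, c t j * (bs g (U (Fin.castLE hm5 j)) l / l) := by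
  have hK := fun t => greedy (c t) (c0 t) (c1 t)
  choose K hK using hK
  refine ⟨{ U := fun j => U (Fin.castLE hm5 j), l := l, hl := hl, hper := fun j => hper _,
            hdisj := fun j j' h => hdisj _ _ (fun h' => h (Fin.castLE_injective hm5 h')),
            hnc := fun j => hnc _, c := c, c0 := c0, c1 := c1, K := K, hK := hK,
            e := fun n => ⟨n % m, Nat.mod_lt n hm⟩, he := ?_ }, rfl, fun g t => rfl⟩
  intro j n0
  refine ⟨m * n0 + j, ?_, ?_⟩
  · have := Nat.le_mul_of_pos_left n0 hm
    omega
  · ext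
    simp [Nat.mod_eq_of_lt j.2]

theorem pair_w (v w b : ℝ) (h1 : v < b) (h2 : b < w) :
    ∃ p q : ℝ, 0 < p ∧ 0 < q ∧ p + q = 1 ∧ p * v + q * w = b := by
  have h : 0 < w - v := by linarith
  refine ⟨(w - b) / (w - v), (b - v) / (w - v), div_pos (by linarith) h, div_pos (by linarith) h,
    ?_, ?_⟩ <;> field_simp <;> ring

theorem core_sys (k : ℕ) (φ : (ℕ → Fin k) → ℝ) (l : ℕ) (U : Fin 5 → ℕ → Fin k) (hl : 0 < l)
    (hper : ∀ j i, U j (i + l) = U j i)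
    (hdisj : ∀ j j', j ≠ j' → ∀ s s', shift^[s] (U j) ≠ shift^[s'] (U j'))
    (hnc : ∀ j, ∃ i, i + 1 < l ∧ U j i ≠ U j (i + 1)) (a b : ℝ)
    (hab : ∀ d : ℝ, d = a ∨ d = b → bs φ (U 0) l / l < d ∧ d < bs φ (U 1) l / l ∧
      bs φ (U 2) l / l < d ∧ d < bs φ (U 3) l / l) (i : Fin 6) :
    ∃ (m : ℕ) (S : Sys k m), (∃ j j' : Fin m, j ≠ j') ∧ S.G φ false = a ∧ S.G φ true = b ∧
      ((caseFlags i).1 = true ↔ ∃ j, ∀ t, 0 < S.c t j) ∧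
      ((caseFlags i).2.1 = true ↔ ∃ j, (∃ t, 0 < S.c t j) ∧ ¬ ∀ t, 0 < S.c t j) ∧
      ((caseFlags i).2.2 = true ↔ ∃ j, ¬ ∃ t, 0 < S.c t j) := by
  obtain ⟨p0, p1, hp0, hp1, hp, hpa⟩ := pair_w _ _ a (hab a (Or.inl rfl)).1 (hab a (Or.inl rfl)).2.1
  obtain ⟨q0, q1, hq0, hq1, hq, hqb⟩ := pair_w _ _ b (hab b (Or.inr rfl)).1 (hab b (Or.inr rfl)).2.1
  obtain ⟨r0, r1, hr0, hr1, hr, hrb⟩ :=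
    pair_w _ _ b (hab b (Or.inr rfl)).2.2.1 (hab b (Or.inr rfl)).2.2.2
  have fin : ∀ (m : ℕ) (hm : 0 < m) (hm5 : m ≤ 5) (c : Bool → Fin m → ℝ)
      (_ : ∀ t j, 0 ≤ c t j) (_ : ∀ t, ∑ j, c t j = 1) (_ : ∃ j j' : Fin m, j ≠ j')
      (_ : ∑ j, c false j * (bs φ (U (Fin.castLE hm5 j)) l / l) = a)
      (_ : ∑ j, c true j * (bs φ (U (Fin.castLE hm5 j)) l / l) = b)
      (_ : (caseFlags i).1 = true ↔ ∃ j, ∀ t, 0 < c t j)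
      (_ : (caseFlags i).2.1 = true ↔ ∃ j, (∃ t, 0 < c t j) ∧ ¬ ∀ t, 0 < c t j)
      (_ : (caseFlags i).2.2 = true ↔ ∃ j, ¬ ∃ t, 0 < c t j),
      ∃ (m : ℕ) (S : Sys k m), (∃ j j' : Fin m, j ≠ j') ∧ S.G φ false = a ∧ S.G φ true = b ∧
      ((caseFlags i).1 = true ↔ ∃ j, ∀ t, 0 < S.c t j) ∧
      ((caseFlags i).2.1 = true ↔ ∃ j, (∃ t, 0 < S.c t j) ∧ ¬ ∀ t, 0 < S.c t j) ∧
      ((caseFlags i).2.2 = true ↔ ∃ j, ¬ ∃ t, 0 < S.c t j) := by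
    intro m hm hm5 c c0 c1 h2 ha hb f1 f2 f3
    obtain ⟨S, rfl, hS⟩ := mk_sys hm hm5 l U hl hper hdisj hnc c c0 c1
    exact ⟨m, S, h2, (hS _ _).trans ha, (hS _ _).trans hb, f1, f2, f3⟩
  have x0 := hp0.le
  have x1 := hp1.le
  have x2 := hq0.le
  have x3 := hq1.le
  have x4 := hr0.le
  have x5 := hr1.le
  fin_cases i
  · refine fin 2 (by norm_num) (by norm_num) (fun t => if t then ![q0, q1] else ![p0, p1])
      ?_ ?_ ⟨0, 1, by decide⟩ ?_ ?_ ?_ ?_ ?_ <;>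
      simp [Fin.forall_fin_succ, Fin.exists_fin_succ, Fin.sum_univ_succ, caseFlags, *]
  · refine fin 3 (by norm_num) (by norm_num) (fun t => if t then ![q0, q1, 0] else ![p0, p1, 0])
      ?_ ?_ ⟨0, 1, by decide⟩ ?_ ?_ ?_ ?_ ?_ <;>
      simp [Fin.forall_fin_succ, Fin.exists_fin_succ, Fin.sum_univ_succ, caseFlags, *]
  · refine fin 4 (by norm_num) (by norm_num) (fun t => if t then ![0, 0, r0, r1] else ![p0, p1, 0, 0])
      ?_ ?_ ⟨0, 1, by decide⟩ ?_ ?_ ?_ ?_ ?_ <;>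
      simp [Fin.forall_fin_succ, Fin.exists_fin_succ, Fin.sum_univ_succ, caseFlags, *]
  · refine fin 4 (by norm_num) (by norm_num) (fun t => if t then ![q0 / 2, q1 / 2, r0 / 2, r1 / 2] else ![p0, p1, 0, 0])
      ?_ ?_ ⟨0, 1, by decide⟩ ?_ ?_ ?_ ?_ ?_ <;>
      simp [Fin.forall_fin_succ, Fin.exists_fin_succ, Fin.sum_univ_succ, caseFlags, *]
    · refine ⟨by linarith, by linarith, by linarith, by linarith⟩
    · linarith
    · linarith
  · refine fin 5 (by norm_num) (by norm_num) (fun t => if t then ![0, 0, r0, r1, 0] else ![p0, p1, 0, 0, 0])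
      ?_ ?_ ⟨0, 1, by decide⟩ ?_ ?_ ?_ ?_ ?_ <;>
      simp [Fin.forall_fin_succ, Fin.exists_fin_succ, Fin.sum_univ_succ, caseFlags, *]
  · refine fin 5 (by norm_num) (by norm_num) (fun t => if t then ![q0 / 2, q1 / 2, r0 / 2, r1 / 2, 0] else ![p0, p1, 0, 0, 0])
      ?_ ?_ ⟨0, 1, by decide⟩ ?_ ?_ ?_ ?_ ?_ <;>
      simp [Fin.forall_fin_succ, Fin.exists_fin_succ, Fin.sum_univ_succ, caseFlags, *]
    · refine ⟨by linarith, by linarith, by linarith, by linarith⟩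
    · linarith
    · linarith

/-- **Theorem C.** For `k ≥ 2`, a continuous `φ : Σ_k → ℝ` with `I_φ(σ) ≠ ∅`, and
`a ∈ Int(L_φ(σ))`, for each `i = 1,…,6` each of the three sets
`I_φ(σ) ∩ {Case (i'), recurrent, not Banach recurrent}`,
`R_φ(a) ∩ {Case (i'), recurrent, not Banach recurrent}`, and
`R_φ ∩ {Case (i'), recurrent, not Banach recurrent}`
contains an uncountable DC1-scrambled subset. -/
theorem multifractal_case_prime_DC1 (k : ℕ) (hk : 2 ≤ k)
    (φ : (ℕ → Fin k) → ℝ) (hφ : Continuous φ)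
    (hirr : ∃ x : ℕ → Fin k, IrregularPt φ x)
    (a : ℝ) (ha : sInf (LphiVals k φ) < a ∧ a < sSup (LphiVals k φ)) (i : Fin 6) :
    (∃ S : Set (ℕ → Fin k),
      S ⊆ {x | IrregularPt φ x ∧ (Recurrent x ∧ ¬ BanachRecurrent x) ∧ SatCase' i x} ∧
      ¬ S.Countable ∧ DC1Scrambled S) ∧
    (∃ S : Set (ℕ → Fin k),
      S ⊆ {x | Filter.Tendsto (birkhoffAvg φ x) Filter.atTop (nhds a) ∧
        (Recurrent x ∧ ¬ BanachRecurrent x) ∧ SatCase' i x} ∧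
      ¬ S.Countable ∧ DC1Scrambled S) ∧
    (∃ S : Set (ℕ → Fin k),
      S ⊆ {x | (∃ b ∈ Set.Icc (sInf (LphiVals k φ)) (sSup (LphiVals k φ)),
          Filter.Tendsto (birkhoffAvg φ x) Filter.atTop (nhds b)) ∧
        (Recurrent x ∧ ¬ BanachRecurrent x) ∧ SatCase' i x} ∧
      ¬ S.Countable ∧ DC1Scrambled S) := by
  obtain ⟨M, hg⟩ := Reg_of_continuous φ hφ
  obtain ⟨l, U, hl, hper, hdisj, hnc, hlo, hhi⟩ := exists_orbits k hk φ hφ hg a ha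
  have v0 := hlo 0 (by decide)
  have v1 := hhi 1 (by decide)
  have v2 := hlo 2 (by decide)
  have v3 := hhi 3 (by decide)
  obtain ⟨b, hab, hb⟩ := exists_between (lt_min v1 v3)
  have hb1 := hb.trans_le (min_le_left _ _)
  have hb3 := hb.trans_le (min_le_right _ _)
  obtain ⟨m, S, h2, ga, gb, f1, f2, f3⟩ := core_sys k φ l U hl hper hdisj hnc a a
    (by rintro d (rfl | rfl) <;> exact ⟨v0, v1, v2, v3⟩) i
  obtain ⟨m', S', h2', ga', gb', f1', f2', f3'⟩ := core_sys k φ l U hl hper hdisj hnc a b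
    (by
      rintro d (rfl | rfl)
      · exact ⟨v0, v1, v2, v3⟩
      · exact ⟨v0.trans hab, hb1, v2.trans hab, hb3⟩) i
  have hG : ∀ t, S.G φ t = a := by
    intro t
    cases t
    · exact ga
    · exact gb
  refine ⟨⟨S'.scr, ?_, S'.scr_unc, S'.scr_dc1⟩, ⟨S.scr, ?_, S.scr_unc, S.scr_dc1⟩,
    ⟨S.scr, ?_, S.scr_unc, S.scr_dc1⟩⟩
  · rintro _ ⟨c, rfl⟩
    refine ⟨S'.x_irreg _ (bit_le c) hg ?_, ⟨S'.x_rec _, S'.x_not_br _ h2'⟩,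
      S'.x_case _ (bit_le c) h2' i f1' f2' f3'⟩
    rw [ga', gb']
    exact hab.ne'
  · rintro _ ⟨c, rfl⟩
    exact ⟨S.x_tendsto _ (bit_le c) hg a hG, ⟨S.x_rec _, S.x_not_br _ h2⟩,
      S.x_case _ (bit_le c) h2 i f1 f2 f3⟩
  · rintro _ ⟨c, rfl⟩
    exact ⟨⟨a, ⟨ha.1.le, ha.2.le⟩, S.x_tendsto _ (bit_le c) hg a hG⟩,
      ⟨S.x_rec _, S.x_not_br _ h2⟩, S.x_case _ (bit_le c) h2 i f1 f2 f3⟩
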